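/- arXiv:2002.01586 — 5 statements merged into one kernel-verified Lean document; each statement's English description precedes it below -/
import Mathlib

section
/- Let κ ≥ 0 and ψ > ψ↓(κ), and let (c₁⋆,c₂⋆,s⋆) ∈ ℝ×(0,∞)×(0,∞) be the unique solution of the nonlinear system. Define V₁(c₁,c₂,s) := c₁ + E_Q[Λ^{−1/2}W·𝒯/D], V₂(c₁,c₂,s) := c₁² + c₂² − E_Q[(Λ^{−1/2}𝒯/D)²], and V₃(c₁,c₂,s) := 1 − E_Q[|Λ^{−1}𝒯/D|] (so solving the system is equivalent to V₁ = V₂ = V₃ = 0). Then for every ε > 0 there exists δ > 0 such that every triple (c₁,c₂,s) ∈ ℝ×(0,∞)×(0,∞) satisfying |V₁(c₁,c₂,s)| ≤ δ·max(c₂,1), |V₂(c₁,c₂,s)| ≤ δ·max(c₂,1)², and |V₃(c₁,c₂,s)| ≤ δ·max(c₂,1) lies within Euclidean distance ε of (c₁⋆,c₂⋆,s⋆). -/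
open MeasureTheory ProbabilityTheory Filter Topology

noncomputable section

/-- Standard Gaussian measure `N(0,1)` on `ℝ`. -/
def stdGaussian : Measure ℝ := gaussianReal 0 1

/-- Expectation of `g (Y, Z₁, Z₂)` where `Z₁, Z₂` are independent standard Gaussians and
`P(Y = 1 | Z₁) = f (ρ Z₁)`. -/
def Egen (ρ : ℝ) (f : ℝ → ℝ) (g : ℝ → ℝ → ℝ → ℝ) : ℝ :=
  ∫ z₁, ∫ z₂, (f (ρ * z₁) * g 1 z₁ z₂ + (1 - f (ρ * z₁)) * g (-1) z₁ z₂)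
    ∂stdGaussian ∂stdGaussian

/-- `F_κ(c₁, c₂)`. -/
def Fk (ρ : ℝ) (f : ℝ → ℝ) (κ c₁ c₂ : ℝ) : ℝ :=
  Real.sqrt (Egen ρ f (fun y z₁ z₂ => (max (κ - c₁ * y * z₁ - c₂ * z₂) 0) ^ 2))

/-- `∂₁ F_κ(c₁, c₂)`. -/
def d1F (ρ : ℝ) (f : ℝ → ℝ) (κ c₁ c₂ : ℝ) : ℝ :=
  -Egen ρ f (fun y z₁ z₂ => y * z₁ * max (κ - c₁ * y * z₁ - c₂ * z₂) 0) / Fk ρ f κ c₁ c₂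

/-- `∂₂ F_κ(c₁, c₂)`. -/
def d2F (ρ : ℝ) (f : ℝ → ℝ) (κ c₁ c₂ : ℝ) : ℝ :=
  -Egen ρ f (fun y z₁ z₂ => z₂ * max (κ - c₁ * y * z₁ - c₂ * z₂) 0) / Fk ρ f κ c₁ c₂

/-- Separability threshold `ψ*(ρ, f)`. -/
def psiSep (ρ : ℝ) (f : ℝ → ℝ) : ℝ := ⨅ c : ℝ, (Fk ρ f 0 c 1) ^ 2

/-- Soft-thresholding operator `prox_s(t) = sign(t) (|t| - s)₊`. -/
def prox (s t : ℝ) : ℝ := Real.sign t * max (|t| - s) 0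

/-- The quantity `𝒯` in the nonlinear system, as a function of `(Λ, W, G) = ((q.1.1, q.1.2), q.2)`. -/
def Tcal (ρ : ℝ) (f : ℝ → ℝ) (ψ κ c₁ c₂ s : ℝ) (q : (ℝ × ℝ) × ℝ) : ℝ :=
  prox s (Real.sqrt q.1.1 * q.2 +
    (Real.sqrt ψ)⁻¹ * (d1F ρ f κ c₁ c₂ - c₁ * c₂⁻¹ * d2F ρ f κ c₁ c₂) * Real.sqrt q.1.1 * q.1.2)

/-- The denominator `D := ψ^{-1/2} c₂⁻¹ ∂₂F_κ(c₁,c₂)`. -/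
def Dval (ρ : ℝ) (f : ℝ → ℝ) (ψ κ c₁ c₂ : ℝ) : ℝ :=
  (Real.sqrt ψ)⁻¹ * c₂⁻¹ * d2F ρ f κ c₁ c₂

/-- The triple `(c₁, c₂, s)` solves the nonlinear system of equations. -/
def SolvesSystem (ρ : ℝ) (f : ℝ → ℝ) (ψ κ : ℝ) (μ : Measure (ℝ × ℝ)) (c₁ c₂ s : ℝ) : Prop :=
  c₁ = -∫ q, (Real.sqrt q.1.1)⁻¹ * q.1.2 * Tcal ρ f ψ κ c₁ c₂ s q / Dval ρ f ψ κ c₁ c₂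
        ∂(μ.prod stdGaussian) ∧
  c₁ ^ 2 + c₂ ^ 2
    = ∫ q, ((Real.sqrt q.1.1)⁻¹ * Tcal ρ f ψ κ c₁ c₂ s q / Dval ρ f ψ κ c₁ c₂) ^ 2
        ∂(μ.prod stdGaussian) ∧
  1 = ∫ q, |q.1.1⁻¹ * Tcal ρ f ψ κ c₁ c₂ s q / Dval ρ f ψ κ c₁ c₂| ∂(μ.prod stdGaussian)

/-- `κ⋆(ψ, ρ, μ)`. -/
def kappaStar (ρ : ℝ) (f : ℝ → ℝ) (ψ : ℝ) (μ : Measure (ℝ × ℝ)) : ℝ :=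
  sInf {κ : ℝ | 0 ≤ κ ∧ ∃ c₁ c₂ s : ℝ, 0 < c₂ ∧ 0 < s ∧ SolvesSystem ρ f ψ κ μ c₁ c₂ s ∧
    (Real.sqrt ψ)⁻¹ * (Fk ρ f κ c₁ c₂ - c₁ * d1F ρ f κ c₁ c₂ - c₂ * d2F ρ f κ c₁ c₂) - s = 0}


/-- `∂₁²F_κ`: second partial derivative of `F_κ` in its first argument. -/
def d11F (ρ : ℝ) (f : ℝ → ℝ) (κ c₁ c₂ : ℝ) : ℝ := deriv (fun t => d1F ρ f κ t c₂) c₁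

/-- `∂₂²F_κ`: second partial derivative of `F_κ` in its second argument. -/
def d22F (ρ : ℝ) (f : ℝ → ℝ) (κ c₁ c₂ : ℝ) : ℝ := deriv (fun t => d2F ρ f κ c₁ t) c₂

/-- `ζ := (∫ |λ^{-1/2} w| dμ)⁻¹`. -/
def zetaC (μ : Measure (ℝ × ℝ)) : ℝ := (∫ q, |(Real.sqrt q.1)⁻¹ * q.2| ∂μ)⁻¹

/-- `ω := (∫ (w - ζ λ^{-1/2} sign(ζ λ^{-1/2} w))² dμ)^{1/2}`. -/
def omegaC (μ : Measure (ℝ × ℝ)) : ℝ :=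
  Real.sqrt (∫ q, (q.2 - zetaC μ * (Real.sqrt q.1)⁻¹ *
    Real.sign (zetaC μ * (Real.sqrt q.1)⁻¹ * q.2)) ^ 2 ∂μ)

/-- `ψ₊(κ)`. -/
def psiPlus (ρ : ℝ) (f : ℝ → ℝ) (μ : Measure (ℝ × ℝ)) (κ : ℝ) : ℝ :=
  if 0 < d1F ρ f κ (zetaC μ) 0 then 0
  else d22F ρ f κ (zetaC μ) 0 - omegaC μ ^ 2 * d11F ρ f κ (zetaC μ) 0

/-- `ψ₋(κ)`. -/
def psiMinus (ρ : ℝ) (f : ℝ → ℝ) (μ : Measure (ℝ × ℝ)) (κ : ℝ) : ℝ :=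
  if d1F ρ f κ (-zetaC μ) 0 < 0 then 0
  else d22F ρ f κ (-zetaC μ) 0 - omegaC μ ^ 2 * d11F ρ f κ (-zetaC μ) 0

/-- `ψ↓(κ) := max{ψ*(ρ,f), ψ₊(κ), ψ₋(κ)}`. -/
def psiDown (ρ : ℝ) (f : ℝ → ℝ) (μ : Measure (ℝ × ℝ)) (κ : ℝ) : ℝ :=
  max (psiSep ρ f) (max (psiPlus ρ f μ κ) (psiMinus ρ f μ κ))

/-- `V₁(c₁,c₂,s) = c₁ + E_Q[Λ^{-1/2} W 𝒯 / D]`. -/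
def V1 (ρ : ℝ) (f : ℝ → ℝ) (ψ κ : ℝ) (μ : Measure (ℝ × ℝ)) (c₁ c₂ s : ℝ) : ℝ :=
  c₁ + ∫ q, (Real.sqrt q.1.1)⁻¹ * q.1.2 * Tcal ρ f ψ κ c₁ c₂ s q / Dval ρ f ψ κ c₁ c₂
        ∂(μ.prod stdGaussian)

/-- `V₂(c₁,c₂,s) = c₁² + c₂² - E_Q[(Λ^{-1/2} 𝒯 / D)²]`. -/
def V2 (ρ : ℝ) (f : ℝ → ℝ) (ψ κ : ℝ) (μ : Measure (ℝ × ℝ)) (c₁ c₂ s : ℝ) : ℝ :=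
  c₁ ^ 2 + c₂ ^ 2 -
    ∫ q, ((Real.sqrt q.1.1)⁻¹ * Tcal ρ f ψ κ c₁ c₂ s q / Dval ρ f ψ κ c₁ c₂) ^ 2
      ∂(μ.prod stdGaussian)

/-- `V₃(c₁,c₂,s) = 1 - E_Q[|Λ^{-1} 𝒯 / D|]`. -/
def V3 (ρ : ℝ) (f : ℝ → ℝ) (ψ κ : ℝ) (μ : Measure (ℝ × ℝ)) (c₁ c₂ s : ℝ) : ℝ :=
  1 - ∫ q, |q.1.1⁻¹ * Tcal ρ f ψ κ c₁ c₂ s q / Dval ρ f ψ κ c₁ c₂| ∂(μ.prod stdGaussian)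

/-! ### Gaussian preliminaries -/

instance isProbabilityMeasure_stdGauss : IsProbabilityMeasure _root_.stdGaussian := by
  unfold _root_.stdGaussian; infer_instance

instance isOpenPosMeasure_stdGauss : Measure.IsOpenPosMeasure _root_.stdGaussian :=
  (gaussianReal_absolutelyContinuous' 0 one_ne_zero).isOpenPosMeasure

lemma integrable_abs_pow_stdGauss (n : ℕ) :
    Integrable (fun x : ℝ => |x| ^ n) _root_.stdGaussian := by
  have h := (memLp_id_gaussianReal' (μ := 0) (v := 1) n (by simp)).integrable_norm_pow'
  simpa [_root_.stdGaussian] using h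

lemma integrable_sq_stdGauss : Integrable (fun x : ℝ => x ^ 2) _root_.stdGaussian := by
  simpa using integrable_abs_pow_stdGauss 2

lemma integral_id_stdGauss : ∫ x, x ∂_root_.stdGaussian = 0 := integral_id_gaussianReal

lemma integral_sq_stdGauss : ∫ x, x ^ 2 ∂_root_.stdGaussian = 1 := by
  have h := variance_fun_id_gaussianReal (μ := 0) (v := 1)
  rw [variance_of_integral_eq_zero (by fun_prop) integral_id_gaussianReal] at h
  simpa [_root_.stdGaussian] using h

lemma measurePreserving_neg_stdGauss :
    MeasurePreserving (fun x : ℝ => -x) _root_.stdGaussian _root_.stdGaussian :=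
  ⟨measurable_neg, by simpa [_root_.stdGaussian] using gaussianReal_map_neg (μ := 0) (v := 1)⟩

/-- Continuity of a parametric integral whose integrand is dominated by a continuous function of
the parameter times a fixed integrable function. -/
lemma continuous_integral_of_dominated_mul {E α : Type*} [TopologicalSpace E]
    [FirstCountableTopology E] [MeasurableSpace α] {ν : Measure α} {G : E → α → ℝ}
    {k : E → ℝ} {b : α → ℝ} (hG : ∀ e, AEStronglyMeasurable (G e) ν)
    (hc : ∀ a, Continuous fun e => G e a) (hk : Continuous k) (hb : Integrable b ν)
    (hbound : ∀ᵐ a ∂ν, 0 ≤ b a ∧ ∀ e, |G e a| ≤ k e * b a) :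
    Continuous fun e => ∫ a, G e a ∂ν := by
  refine continuous_iff_continuousAt.2 fun e₀ => ?_
  refine continuousAt_of_dominated (bound := fun a => (k e₀ + 1) * b a) (.of_forall hG) ?_
    (hb.const_mul _) (.of_forall fun a => (hc a).continuousAt)
  filter_upwards [hk.continuousAt.eventually (Iio_mem_nhds (lt_add_one (k e₀)))] with e he
  filter_upwards [hbound] with a ha
  exact (ha.2 e).trans (mul_le_mul_of_nonneg_right (le_of_lt he) ha.1)

/-! ### The law of `(Y Z₁, Z₂)` -/

/-- Density of the law of `Y Z₁` with respect to the standard Gaussian measure. -/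
def labelDensity (ρ : ℝ) (f : ℝ → ℝ) (u : ℝ) : ℝ := f (ρ * u) + (1 - f (ρ * -u))

/-- The law of `(Y Z₁, Z₂)`. -/
def labelMeasure (ρ : ℝ) (f : ℝ → ℝ) : Measure (ℝ × ℝ) :=
  (_root_.stdGaussian.prod _root_.stdGaussian).withDensity
    fun p => ((labelDensity ρ f p.1).toNNReal : ENNReal)

section LabelMeasure

variable {ρ : ℝ} {f : ℝ → ℝ}

lemma labelDensity_nonneg (hf : ∀ t, f t ∈ Set.Icc (0 : ℝ) 1) (u : ℝ) :
    0 ≤ labelDensity ρ f u := by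
  unfold labelDensity
  linarith [(hf (ρ * u)).1, (hf (ρ * -u)).2]

lemma labelDensity_le (hf : ∀ t, f t ∈ Set.Icc (0 : ℝ) 1) (u : ℝ) :
    labelDensity ρ f u ≤ 2 := by
  unfold labelDensity
  linarith [(hf (ρ * u)).2, (hf (ρ * -u)).1]

lemma continuous_labelDensity (hf : Continuous f) : Continuous (labelDensity ρ f) := by
  unfold labelDensity
  fun_prop

lemma integral_labelMeasure (hfc : Continuous f) (hf : ∀ t, f t ∈ Set.Icc (0 : ℝ) 1)
    (g : ℝ × ℝ → ℝ) :
    ∫ p, g p ∂labelMeasure ρ f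
      = ∫ p, labelDensity ρ f p.1 * g p ∂(_root_.stdGaussian.prod _root_.stdGaussian) := by
  have hm : Measurable fun p : ℝ × ℝ => (labelDensity ρ f p.1).toNNReal :=
    ((continuous_labelDensity hfc).measurable.comp measurable_fst).real_toNNReal
  rw [labelMeasure, integral_withDensity_eq_integral_smul hm]
  refine integral_congr_ae (.of_forall fun p => ?_)
  simp [NNReal.smul_def, Real.coe_toNNReal _ (labelDensity_nonneg hf p.1)]

lemma labelMeasure_le (hf : ∀ t, f t ∈ Set.Icc (0 : ℝ) 1) :
    labelMeasure ρ f ≤ (2 : ENNReal) • (_root_.stdGaussian.prod _root_.stdGaussian) := by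
  rw [labelMeasure, ← withDensity_const]
  refine withDensity_mono (.of_forall fun p => ?_)
  have h : (labelDensity ρ f p.1).toNNReal ≤ 2 :=
    Real.toNNReal_le_iff_le_coe.2 (labelDensity_le hf p.1)
  change ((labelDensity ρ f p.1).toNNReal : ENNReal) ≤ ((2 : NNReal) : ENNReal)
  exact ENNReal.coe_le_coe.2 h

lemma integrable_labelMeasure (hf : ∀ t, f t ∈ Set.Icc (0 : ℝ) 1) {g : ℝ × ℝ → ℝ}
    (hg : Integrable g (_root_.stdGaussian.prod _root_.stdGaussian)) :
    Integrable g (labelMeasure ρ f) :=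
  (hg.smul_measure (by simp)).mono_measure (labelMeasure_le hf)

/-- The quadratic envelope dominating all integrands below. -/
def quadEnvelope (p : ℝ × ℝ) : ℝ := 1 + p.1 ^ 2 + p.2 ^ 2

lemma quadEnvelope_nonneg (p : ℝ × ℝ) : 0 ≤ quadEnvelope p := by
  unfold quadEnvelope; positivity

lemma integrable_fst_sq :
    Integrable (fun p : ℝ × ℝ => p.1 ^ 2) (_root_.stdGaussian.prod _root_.stdGaussian) :=
  integrable_sq_stdGauss.comp_fst _

lemma integrable_snd_sq :
    Integrable (fun p : ℝ × ℝ => p.2 ^ 2) (_root_.stdGaussian.prod _root_.stdGaussian) :=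
  integrable_sq_stdGauss.comp_snd _

lemma integrable_quadEnvelope :
    Integrable quadEnvelope (_root_.stdGaussian.prod _root_.stdGaussian) :=
  ((integrable_const 1).add integrable_fst_sq).add integrable_snd_sq

lemma integrable_of_le_quadEnvelope {g : ℝ × ℝ → ℝ} (hg : Continuous g) {C : ℝ}
    (hC : ∀ p, |g p| ≤ C * quadEnvelope p) :
    Integrable g (_root_.stdGaussian.prod _root_.stdGaussian) :=
  (integrable_quadEnvelope.const_mul C).mono' hg.aestronglyMeasurable (.of_forall hC)

/-- An expectation of a function of `(Y Z₁, Z₂)` is an integral against `labelMeasure`. -/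
lemma Egen_eq_integral (hfc : Continuous f) (hf : ∀ t, f t ∈ Set.Icc (0 : ℝ) 1)
    {g : ℝ × ℝ → ℝ} (hg : Continuous g) {C : ℝ} (hC : ∀ p, |g p| ≤ C * quadEnvelope p) :
    Egen ρ f (fun y z₁ z₂ => g (y * z₁, z₂)) = ∫ p, g p ∂labelMeasure ρ f := by
  have hgi := integrable_of_le_quadEnvelope hg hC
  have hmp : MeasurePreserving (fun p : ℝ × ℝ => (-p.1, p.2))
      (_root_.stdGaussian.prod _root_.stdGaussian)
      (_root_.stdGaussian.prod _root_.stdGaussian) :=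
    measurePreserving_neg_stdGauss.prod (MeasurePreserving.id _)
  have hemb : MeasurableEmbedding (fun p : ℝ × ℝ => (-p.1, p.2)) :=
    ((MeasurableEquiv.neg ℝ).prodCongr (MeasurableEquiv.refl ℝ)).measurableEmbedding
  have hgn : Integrable (fun p : ℝ × ℝ => g (-p.1, p.2))
      (_root_.stdGaussian.prod _root_.stdGaussian) := (hmp.integrable_comp_emb hemb).2 hgi
  have i1 : Integrable (fun p : ℝ × ℝ => f (ρ * p.1) * g p)
      (_root_.stdGaussian.prod _root_.stdGaussian) := by
    refine hgi.bdd_mul (c := 1) (by fun_prop) (.of_forall fun p => ?_)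
    rw [Real.norm_eq_abs, abs_of_nonneg (hf _).1]
    exact (hf _).2
  have i2 : Integrable (fun p : ℝ × ℝ => (1 - f (ρ * p.1)) * g (-p.1, p.2))
      (_root_.stdGaussian.prod _root_.stdGaussian) := by
    refine hgn.bdd_mul (c := 1) (by fun_prop) (.of_forall fun p => ?_)
    rw [Real.norm_eq_abs, abs_of_nonneg (by linarith [(hf (ρ * p.1)).2])]
    linarith [(hf (ρ * p.1)).1]
  have i3 : Integrable (fun p : ℝ × ℝ => (1 - f (ρ * -p.1)) * g p)
      (_root_.stdGaussian.prod _root_.stdGaussian) := by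
    refine hgi.bdd_mul (c := 1) (by fun_prop) (.of_forall fun p => ?_)
    rw [Real.norm_eq_abs, abs_of_nonneg (by linarith [(hf (ρ * -p.1)).2])]
    linarith [(hf (ρ * -p.1)).1]
  have h2 := hmp.integral_comp hemb (fun p : ℝ × ℝ => (1 - f (ρ * -p.1)) * g p)
  simp only [neg_neg] at h2
  rw [integral_labelMeasure hfc hf]
  simp only [labelDensity, add_mul]
  rw [integral_add i1 i3, ← h2, ← integral_add i1 i2]
  simpa [Egen] using (integral_prod _ (i1.add i2)).symm

/-! ### The margin functional -/

/-- The hinge residual `(κ - c₁ u - c₂ z)₊`. -/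
def hinge (κ c₁ c₂ : ℝ) (p : ℝ × ℝ) : ℝ := max (κ - c₁ * p.1 - c₂ * p.2) 0

lemma hinge_nonneg (κ c₁ c₂ : ℝ) (p : ℝ × ℝ) : 0 ≤ hinge κ c₁ c₂ p := le_max_right _ _

lemma continuous_hinge (κ c₁ c₂ : ℝ) : Continuous (hinge κ c₁ c₂) := by
  unfold hinge; fun_prop

lemma hinge_sq_le (κ c₁ c₂ : ℝ) (p : ℝ × ℝ) :
    hinge κ c₁ c₂ p ^ 2 ≤ 3 * (κ ^ 2 + c₁ ^ 2 + c₂ ^ 2) * quadEnvelope p := by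
  have h1 : hinge κ c₁ c₂ p ^ 2 ≤ (κ - c₁ * p.1 - c₂ * p.2) ^ 2 := by
    unfold hinge
    rcases max_cases (κ - c₁ * p.1 - c₂ * p.2) 0 with h | h <;> rw [h.1]
    nlinarith [sq_nonneg (κ - c₁ * p.1 - c₂ * p.2)]
  have h2 : (κ - c₁ * p.1 - c₂ * p.2) ^ 2
      ≤ 3 * (κ ^ 2 + c₁ ^ 2 * p.1 ^ 2 + c₂ ^ 2 * p.2 ^ 2) := by
    nlinarith [sq_nonneg (κ + c₁ * p.1), sq_nonneg (κ + c₂ * p.2),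
      sq_nonneg (c₁ * p.1 - c₂ * p.2)]
  have h3 : κ ^ 2 + c₁ ^ 2 * p.1 ^ 2 + c₂ ^ 2 * p.2 ^ 2
      ≤ (κ ^ 2 + c₁ ^ 2 + c₂ ^ 2) * quadEnvelope p := by
    have := mul_nonneg (sq_nonneg κ) (add_nonneg (sq_nonneg p.1) (sq_nonneg p.2))
    have := mul_nonneg (sq_nonneg c₁) (add_nonneg zero_le_one (sq_nonneg p.2))
    have := mul_nonneg (sq_nonneg c₂) (add_nonneg zero_le_one (sq_nonneg p.1))
    unfold quadEnvelope
    nlinarith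
  linarith

/-- The constant dominating the hinge integrands. -/
def hingeBound (κ : ℝ) (c : ℝ × ℝ) : ℝ := 3 * (κ ^ 2 + c.1 ^ 2 + c.2 ^ 2) + 1

lemma abs_hinge_sq_le (κ c₁ c₂ : ℝ) (p : ℝ × ℝ) :
    |hinge κ c₁ c₂ p ^ 2| ≤ hingeBound κ (c₁, c₂) * quadEnvelope p := by
  rw [abs_of_nonneg (sq_nonneg _)]
  have := hinge_sq_le κ c₁ c₂ p
  have := quadEnvelope_nonneg p
  unfold hingeBound
  nlinarith

lemma abs_fst_mul_hinge_le (κ c₁ c₂ : ℝ) (p : ℝ × ℝ) :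
    |p.1 * hinge κ c₁ c₂ p| ≤ hingeBound κ (c₁, c₂) * quadEnvelope p := by
  have h1 := hinge_sq_le κ c₁ c₂ p
  have h2 : p.1 ^ 2 ≤ quadEnvelope p := by unfold quadEnvelope; nlinarith [sq_nonneg p.2]
  have h3 := sq_nonneg (|p.1| - hinge κ c₁ c₂ p)
  rw [abs_mul, abs_of_nonneg (hinge_nonneg _ _ _ _)]
  have h4 := sq_abs p.1
  have h5 := quadEnvelope_nonneg p
  have h6 := sq_nonneg (hinge κ c₁ c₂ p)
  unfold hingeBound
  nlinarith

lemma abs_snd_mul_hinge_le (κ c₁ c₂ : ℝ) (p : ℝ × ℝ) :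
    |p.2 * hinge κ c₁ c₂ p| ≤ hingeBound κ (c₁, c₂) * quadEnvelope p := by
  have h1 := hinge_sq_le κ c₁ c₂ p
  have h2 : p.2 ^ 2 ≤ quadEnvelope p := by unfold quadEnvelope; nlinarith [sq_nonneg p.1]
  have h3 := sq_nonneg (|p.2| - hinge κ c₁ c₂ p)
  rw [abs_mul, abs_of_nonneg (hinge_nonneg _ _ _ _)]
  have h4 := sq_abs p.2
  have h5 := quadEnvelope_nonneg p
  have h6 := sq_nonneg (hinge κ c₁ c₂ p)
  unfold hingeBound
  nlinarith

lemma integrable_hinge_sq (hf : ∀ t, f t ∈ Set.Icc (0 : ℝ) 1) (κ c₁ c₂ : ℝ) :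
    Integrable (fun p => hinge κ c₁ c₂ p ^ 2) (labelMeasure ρ f) :=
  integrable_labelMeasure hf (integrable_of_le_quadEnvelope
    ((continuous_hinge κ c₁ c₂).pow 2) (abs_hinge_sq_le κ c₁ c₂))

lemma integrable_fst_mul_hinge (hf : ∀ t, f t ∈ Set.Icc (0 : ℝ) 1) (κ c₁ c₂ : ℝ) :
    Integrable (fun p => p.1 * hinge κ c₁ c₂ p) (labelMeasure ρ f) :=
  integrable_labelMeasure hf (integrable_of_le_quadEnvelope
    (continuous_fst.mul (continuous_hinge κ c₁ c₂)) (abs_fst_mul_hinge_le κ c₁ c₂))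

lemma integrable_snd_mul_hinge (hf : ∀ t, f t ∈ Set.Icc (0 : ℝ) 1) (κ c₁ c₂ : ℝ) :
    Integrable (fun p => p.2 * hinge κ c₁ c₂ p) (labelMeasure ρ f) :=
  integrable_labelMeasure hf (integrable_of_le_quadEnvelope
    (continuous_snd.mul (continuous_hinge κ c₁ c₂)) (abs_snd_mul_hinge_le κ c₁ c₂))

lemma Fk_eq (hfc : Continuous f) (hf : ∀ t, f t ∈ Set.Icc (0 : ℝ) 1) (κ c₁ c₂ : ℝ) :
    Fk ρ f κ c₁ c₂ = √(∫ p, hinge κ c₁ c₂ p ^ 2 ∂labelMeasure ρ f) := by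
  rw [← Egen_eq_integral hfc hf (g := fun p => hinge κ c₁ c₂ p ^ 2) ((continuous_hinge κ c₁ c₂).pow 2) (abs_hinge_sq_le κ c₁ c₂)]
  simp only [Fk, hinge, ← mul_assoc]

lemma d1F_eq (hfc : Continuous f) (hf : ∀ t, f t ∈ Set.Icc (0 : ℝ) 1) (κ c₁ c₂ : ℝ) :
    d1F ρ f κ c₁ c₂ = -(∫ p, p.1 * hinge κ c₁ c₂ p ∂labelMeasure ρ f) / Fk ρ f κ c₁ c₂ := by
  rw [← Egen_eq_integral hfc hf (g := fun p => p.1 * hinge κ c₁ c₂ p) (continuous_fst.mul (continuous_hinge κ c₁ c₂))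
    (abs_fst_mul_hinge_le κ c₁ c₂)]
  simp only [d1F, hinge, ← mul_assoc]

lemma d2F_eq (hfc : Continuous f) (hf : ∀ t, f t ∈ Set.Icc (0 : ℝ) 1) (κ c₁ c₂ : ℝ) :
    d2F ρ f κ c₁ c₂ = -(∫ p, p.2 * hinge κ c₁ c₂ p ∂labelMeasure ρ f) / Fk ρ f κ c₁ c₂ := by
  rw [← Egen_eq_integral hfc hf (g := fun p => p.2 * hinge κ c₁ c₂ p) (continuous_snd.mul (continuous_hinge κ c₁ c₂))
    (abs_snd_mul_hinge_le κ c₁ c₂)]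
  simp only [d2F, hinge, ← mul_assoc]

lemma Fk_nonneg (κ c₁ c₂ : ℝ) : 0 ≤ Fk ρ f κ c₁ c₂ := Real.sqrt_nonneg _

lemma Fk_sq (hfc : Continuous f) (hf : ∀ t, f t ∈ Set.Icc (0 : ℝ) 1) (κ c₁ c₂ : ℝ) :
    Fk ρ f κ c₁ c₂ ^ 2 = ∫ p, hinge κ c₁ c₂ p ^ 2 ∂labelMeasure ρ f := by
  rw [Fk_eq hfc hf, Real.sq_sqrt (integral_nonneg fun p => sq_nonneg _)]

lemma continuous_hinge_left (κ : ℝ) (p : ℝ × ℝ) :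
    Continuous fun c : ℝ × ℝ => hinge κ c.1 c.2 p := by
  unfold hinge; fun_prop

lemma continuous_hingeBound (κ : ℝ) : Continuous (hingeBound κ) := by
  unfold hingeBound; fun_prop

lemma continuous_Fk (hfc : Continuous f) (hf : ∀ t, f t ∈ Set.Icc (0 : ℝ) 1) (κ : ℝ) :
    Continuous fun c : ℝ × ℝ => Fk ρ f κ c.1 c.2 := by
  simp only [Fk_eq hfc hf]
  refine Real.continuous_sqrt.comp ?_
  exact continuous_integral_of_dominated_mul
    (fun c => (integrable_hinge_sq hf κ c.1 c.2).aestronglyMeasurable)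
    (fun p => (continuous_hinge_left κ p).pow 2) (continuous_hingeBound κ)
    (integrable_labelMeasure hf integrable_quadEnvelope)
    (.of_forall fun p => ⟨quadEnvelope_nonneg p, fun c => abs_hinge_sq_le κ c.1 c.2 p⟩)

lemma continuous_integral_fst_mul_hinge (hf : ∀ t, f t ∈ Set.Icc (0 : ℝ) 1) (κ : ℝ) :
    Continuous fun c : ℝ × ℝ => ∫ p, p.1 * hinge κ c.1 c.2 p ∂labelMeasure ρ f :=
  continuous_integral_of_dominated_mul
    (fun c => (integrable_fst_mul_hinge hf κ c.1 c.2).aestronglyMeasurable)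
    (fun p => continuous_const.mul (continuous_hinge_left κ p)) (continuous_hingeBound κ)
    (integrable_labelMeasure hf integrable_quadEnvelope)
    (.of_forall fun p => ⟨quadEnvelope_nonneg p, fun c => abs_fst_mul_hinge_le κ c.1 c.2 p⟩)

lemma continuous_integral_snd_mul_hinge (hf : ∀ t, f t ∈ Set.Icc (0 : ℝ) 1) (κ : ℝ) :
    Continuous fun c : ℝ × ℝ => ∫ p, p.2 * hinge κ c.1 c.2 p ∂labelMeasure ρ f :=
  continuous_integral_of_dominated_mul
    (fun c => (integrable_snd_mul_hinge hf κ c.1 c.2).aestronglyMeasurable)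
    (fun p => continuous_const.mul (continuous_hinge_left κ p)) (continuous_hingeBound κ)
    (integrable_labelMeasure hf integrable_quadEnvelope)
    (.of_forall fun p => ⟨quadEnvelope_nonneg p, fun c => abs_snd_mul_hinge_le κ c.1 c.2 p⟩)

lemma continuousAt_d1F (hfc : Continuous f) (hf : ∀ t, f t ∈ Set.Icc (0 : ℝ) 1) (κ : ℝ)
    {c : ℝ × ℝ} (hF : 0 < Fk ρ f κ c.1 c.2) :
    ContinuousAt (fun c : ℝ × ℝ => d1F ρ f κ c.1 c.2) c := by
  simp only [d1F_eq hfc hf]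
  exact (continuous_integral_fst_mul_hinge hf κ).continuousAt.neg.div
    (continuous_Fk hfc hf κ).continuousAt hF.ne'

lemma continuousAt_d2F (hfc : Continuous f) (hf : ∀ t, f t ∈ Set.Icc (0 : ℝ) 1) (κ : ℝ)
    {c : ℝ × ℝ} (hF : 0 < Fk ρ f κ c.1 c.2) :
    ContinuousAt (fun c : ℝ × ℝ => d2F ρ f κ c.1 c.2) c := by
  simp only [d2F_eq hfc hf]
  exact (continuous_integral_snd_mul_hinge hf κ).continuousAt.neg.div
    (continuous_Fk hfc hf κ).continuousAt hF.ne'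

/-- A continuous minorant supported on the quadrant where `σ u < 0` and `z < 0`. -/
def quadrantSq (σ : ℝ) (p : ℝ × ℝ) : ℝ := min (max (-(σ * p.1)) 0) (max (-p.2) 0) ^ 2

lemma continuous_quadrantSq (σ : ℝ) : Continuous (quadrantSq σ) := by
  unfold quadrantSq; fun_prop

lemma quadrantSq_eq_zero {σ : ℝ} {p : ℝ × ℝ} (h : 0 ≤ σ * p.1 ∨ 0 ≤ p.2) :
    quadrantSq σ p = 0 := by
  unfold quadrantSq
  rcases h with h | h
  · rw [max_eq_right (by linarith : -(σ * p.1) ≤ 0), min_eq_left (le_max_right _ _)]; simp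
  · rw [max_eq_right (by linarith : -p.2 ≤ 0), min_eq_right (le_max_right _ _)]; simp

lemma quadrantSq_eq {σ : ℝ} {p : ℝ × ℝ} (h1 : σ * p.1 < 0) (h2 : p.2 < 0) :
    quadrantSq σ p = min (-(σ * p.1)) (-p.2) ^ 2 := by
  unfold quadrantSq
  rw [max_eq_left (by linarith), max_eq_left (by linarith)]

lemma quadrantSq_le (σ : ℝ) (p : ℝ × ℝ) : quadrantSq σ p ≤ p.2 ^ 2 := by
  by_cases h : 0 ≤ σ * p.1 ∨ 0 ≤ p.2
  · rw [quadrantSq_eq_zero h]; positivity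
  · push Not at h
    rw [quadrantSq_eq h.1 h.2, ← neg_sq p.2]
    exact pow_le_pow_left₀ (le_min (by linarith) (by linarith)) (min_le_right _ _) 2

lemma integrable_quadrantSq (hf : ∀ t, f t ∈ Set.Icc (0 : ℝ) 1) (σ : ℝ) :
    Integrable (quadrantSq σ) (labelMeasure ρ f) := by
  refine (integrable_labelMeasure hf integrable_snd_sq).mono'
    (continuous_quadrantSq σ).aestronglyMeasurable (.of_forall fun p => ?_)
  rw [Real.norm_eq_abs, abs_of_nonneg (by unfold quadrantSq; positivity)]
  exact quadrantSq_le σ p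

/-- Both quadrants `±u < 0`, `z < 0` are charged by the law of `(Y Z₁, Z₂)`. -/
lemma integral_quadrantSq_pos (hfc : Continuous f) (hf : ∀ t, f t ∈ Set.Icc (0 : ℝ) 1)
    {σ : ℝ} (hσ : σ ≠ 0) : 0 < ∫ p, quadrantSq σ p ∂labelMeasure ρ f := by
  have h0 : 0 < labelDensity ρ f 0 := by simp [labelDensity]
  have hcd := continuous_labelDensity (ρ := ρ) hfc
  have hnn : ∀ p : ℝ × ℝ, 0 ≤ labelDensity ρ f p.1 * quadrantSq σ p := fun p =>
    mul_nonneg (labelDensity_nonneg hf _) (by unfold quadrantSq; positivity)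
  have hcont : Continuous fun p : ℝ × ℝ => labelDensity ρ f p.1 * quadrantSq σ p :=
    (hcd.comp continuous_fst).mul (continuous_quadrantSq σ)
  have hint : Integrable (fun p : ℝ × ℝ => labelDensity ρ f p.1 * quadrantSq σ p)
      (_root_.stdGaussian.prod _root_.stdGaussian) := by
    refine integrable_of_le_quadEnvelope hcont (C := 2) fun p => ?_
    rw [abs_of_nonneg (hnn p)]
    refine mul_le_mul (labelDensity_le hf _) ((quadrantSq_le σ p).trans ?_)
      (by unfold quadrantSq; positivity) (by norm_num)
    unfold quadEnvelope
    nlinarith [sq_nonneg p.1]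
  rw [integral_labelMeasure hfc hf, integral_pos_iff_support_of_nonneg hnn hint]
  refine hcont.isOpen_support.measure_pos _ ?_
  obtain ⟨r, hr, hball⟩ := Metric.eventually_nhds_iff.1
    (hcd.continuousAt.eventually (lt_mem_nhds h0))
  have hs : 0 < σ * σ := mul_self_pos.2 hσ
  refine ⟨(-(r / (2 * |σ|)) * σ, -1), ?_⟩
  have hd : 0 < labelDensity ρ f (-(r / (2 * |σ|)) * σ) := by
    apply hball
    have : |σ| ≠ 0 := abs_ne_zero.2 hσ
    rw [Real.dist_eq, sub_zero, abs_mul, abs_neg, abs_div, abs_mul, abs_abs, abs_of_pos hr, abs_two]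
    field_simp
    linarith
  have hpos : 0 < r / (2 * |σ|) := div_pos hr (by positivity)
  have h1 : σ * (-(r / (2 * |σ|)) * σ) < 0 := by nlinarith
  rw [Function.mem_support, quadrantSq_eq h1 (by norm_num)]
  refine mul_ne_zero hd.ne' (pow_ne_zero _ (ne_of_gt (lt_min ?_ ?_)))
  · linarith
  · norm_num

lemma quadrantSq_mul_le_hinge_sq {κ k c₂ σ : ℝ} (hκ : 0 ≤ κ) (hk : 0 ≤ k) (hc₂ : 0 ≤ c₂)
    (p : ℝ × ℝ) :
    (k ^ 2 + c₂ ^ 2) * quadrantSq σ p ≤ hinge κ (σ * k) c₂ p ^ 2 := by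
  by_cases h : 0 ≤ σ * p.1 ∨ 0 ≤ p.2
  · rw [quadrantSq_eq_zero h]; simp [sq_nonneg]
  · push Not at h
    rw [quadrantSq_eq h.1 h.2]
    set m := min (-(σ * p.1)) (-p.2) with hm
    have hm0 : 0 ≤ m := le_min (by linarith) (by linarith)
    have h1 : k * m ≤ k * (-(σ * p.1)) := mul_le_mul_of_nonneg_left (min_le_left _ _) hk
    have h2 : c₂ * m ≤ c₂ * (-p.2) := mul_le_mul_of_nonneg_left (min_le_right _ _) hc₂
    have h3 : k * m + c₂ * m ≤ hinge κ (σ * k) c₂ p := by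
      refine le_trans ?_ (le_max_left _ _)
      linarith
    have h4 : (k * m + c₂ * m) ^ 2 ≤ hinge κ (σ * k) c₂ p ^ 2 :=
      pow_le_pow_left₀ (by positivity) h3 2
    nlinarith [mul_nonneg (mul_nonneg hk hc₂) (sq_nonneg m)]

lemma quadrantSq_mul_le_snd_mul {κ k c₂ σ : ℝ} (hκ : 0 ≤ κ) (hk : 0 ≤ k) (hc₂ : 0 ≤ c₂)
    (p : ℝ × ℝ) :
    c₂ * quadrantSq σ p ≤ p.2 * hinge κ (σ * k) 0 p - p.2 * hinge κ (σ * k) c₂ p := by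
  rw [← mul_sub]
  by_cases h : 0 ≤ σ * p.1 ∨ 0 ≤ p.2
  · rw [quadrantSq_eq_zero h, mul_zero]
    unfold hinge
    rcases le_total 0 p.2 with hz | hz
    · exact mul_nonneg hz (sub_nonneg.2 (max_le_max (by nlinarith) le_rfl))
    · exact mul_nonneg_of_nonpos_of_nonpos hz
        (sub_nonpos.2 (max_le_max (by nlinarith) le_rfl))
  · push Not at h
    have h1 : σ * k * p.1 ≤ 0 := by nlinarith
    have h2 := mul_le_mul_of_nonneg_left (quadrantSq_le σ p) hc₂
    have h3 : 0 ≤ c₂ * (-p.2) := mul_nonneg hc₂ (by linarith)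
    unfold hinge
    rw [max_eq_left (by linarith), max_eq_left (by linarith)]
    nlinarith

lemma snd_mul_hinge_sub_le {κ c₁ c₂ : ℝ} (hc₂ : 0 ≤ c₂) (p : ℝ × ℝ) :
    p.2 * hinge κ c₁ 0 p - p.2 * hinge κ c₁ c₂ p ≤ c₂ * p.2 ^ 2 := by
  have h : |hinge κ c₁ 0 p - hinge κ c₁ c₂ p| ≤ |c₂ * p.2| := by
    unfold hinge
    refine (abs_max_sub_max_le_abs _ _ _).trans (le_of_eq ?_)
    congr 1; ring
  rw [← mul_sub]
  calc p.2 * (hinge κ c₁ 0 p - hinge κ c₁ c₂ p)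
      ≤ |p.2| * |hinge κ c₁ 0 p - hinge κ c₁ c₂ p| := by rw [← abs_mul]; exact le_abs_self _
    _ ≤ |p.2| * |c₂ * p.2| := mul_le_mul_of_nonneg_left h (abs_nonneg _)
    _ = c₂ * p.2 ^ 2 := by rw [abs_mul, abs_of_nonneg hc₂, ← sq_abs p.2]; ring

lemma integral_snd_mul_hinge_zero (hfc : Continuous f) (hf : ∀ t, f t ∈ Set.Icc (0 : ℝ) 1)
    (κ c₁ : ℝ) : ∫ p, p.2 * hinge κ c₁ 0 p ∂labelMeasure ρ f = 0 := by
  rw [integral_labelMeasure hfc hf]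
  have h := integral_prod_mul (μ := _root_.stdGaussian) (ν := _root_.stdGaussian)
    (fun u : ℝ => labelDensity ρ f u * max (κ - c₁ * u) 0) (fun z : ℝ => z)
  rw [integral_id_stdGauss, mul_zero] at h
  refine Eq.trans (integral_congr_ae (.of_forall fun p => ?_)) h
  simp only [hinge, zero_mul, sub_zero]
  ring

/-- Two-sided bounds on the margin functional and its gradient. -/
lemma exists_margin_bounds (hfc : Continuous f) (hf : ∀ t, f t ∈ Set.Icc (0 : ℝ) 1) :
    ∃ q > 0, ∃ C > 0, ∀ κ c₁ c₂ : ℝ, 0 ≤ κ → 0 < c₂ →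
      q ^ 2 * (c₁ ^ 2 + c₂ ^ 2) ≤ Fk ρ f κ c₁ c₂ ^ 2 ∧
      Fk ρ f κ c₁ c₂ ^ 2 ≤ C ^ 2 * (κ ^ 2 + c₁ ^ 2 + c₂ ^ 2) ∧
      q ^ 2 * c₂ ≤ d2F ρ f κ c₁ c₂ * Fk ρ f κ c₁ c₂ ∧
      d2F ρ f κ c₁ c₂ * Fk ρ f κ c₁ c₂ ≤ C * c₂ ∧
      |d1F ρ f κ c₁ c₂| ≤ C := by
  have hp1 := integral_quadrantSq_pos (ρ := ρ) hfc hf one_ne_zero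
  have hp2 := integral_quadrantSq_pos (ρ := ρ) hfc hf (neg_ne_zero.2 one_ne_zero)
  set w := min (∫ p, quadrantSq 1 p ∂labelMeasure ρ f)
    (∫ p, quadrantSq (-1) p ∂labelMeasure ρ f) with hw
  have hw0 : 0 < w := lt_min hp1 hp2
  set E := ∫ p, quadEnvelope p ∂labelMeasure ρ f with hE
  have hEnv : Integrable quadEnvelope (labelMeasure ρ f) :=
    integrable_labelMeasure hf integrable_quadEnvelope
  have hfst : Integrable (fun p : ℝ × ℝ => p.1 ^ 2) (labelMeasure ρ f) :=
    integrable_labelMeasure hf integrable_fst_sq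
  have hsnd : Integrable (fun p : ℝ × ℝ => p.2 ^ 2) (labelMeasure ρ f) :=
    integrable_labelMeasure hf integrable_snd_sq
  have hE0 : 0 ≤ E := integral_nonneg quadEnvelope_nonneg
  have hfstE : ∫ p, p.1 ^ 2 ∂labelMeasure ρ f ≤ E := integral_mono hfst hEnv fun p => by
    change p.1 ^ 2 ≤ 1 + p.1 ^ 2 + p.2 ^ 2
    nlinarith [sq_nonneg p.2]
  have hsndE : ∫ p, p.2 ^ 2 ∂labelMeasure ρ f ≤ E := integral_mono hsnd hEnv fun p => by
    change p.2 ^ 2 ≤ 1 + p.1 ^ 2 + p.2 ^ 2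
    nlinarith [sq_nonneg p.1]
  refine ⟨√w, Real.sqrt_pos.2 hw0, 3 * E + 1, by positivity, fun κ c₁ c₂ hκ hc₂ => ?_⟩
  rw [Real.sq_sqrt hw0.le]
  obtain ⟨σ, k, hσ, hk, rfl, hσw⟩ : ∃ σ k : ℝ, σ ^ 2 = 1 ∧ 0 ≤ k ∧ σ * k = c₁ ∧
      w ≤ ∫ p, quadrantSq σ p ∂labelMeasure ρ f := by
    rcases le_total 0 c₁ with h | h
    · exact ⟨1, c₁, by norm_num, h, one_mul _, min_le_left _ _⟩
    · exact ⟨-1, -c₁, by norm_num, by linarith, by ring, min_le_right _ _⟩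
  have hsq : (σ * k) ^ 2 = k ^ 2 := by rw [mul_pow, hσ, one_mul]
  have hA : w * (k ^ 2 + c₂ ^ 2) ≤ Fk ρ f κ (σ * k) c₂ ^ 2 := by
    rw [Fk_sq hfc hf]
    calc w * (k ^ 2 + c₂ ^ 2)
        ≤ (k ^ 2 + c₂ ^ 2) * ∫ p, quadrantSq σ p ∂labelMeasure ρ f := by
          rw [mul_comm]; exact mul_le_mul_of_nonneg_left hσw (by positivity)
      _ = ∫ p, (k ^ 2 + c₂ ^ 2) * quadrantSq σ p ∂labelMeasure ρ f :=
          (integral_const_mul _ _).symm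
      _ ≤ _ := integral_mono ((integrable_quadrantSq hf σ).const_mul _)
          (integrable_hinge_sq hf _ _ _)
          fun p => quadrantSq_mul_le_hinge_sq hκ hk hc₂.le p
  have hF : 0 < Fk ρ f κ (σ * k) c₂ := by
    refine lt_of_le_of_ne (Fk_nonneg _ _ _) fun h => ?_
    rw [← h] at hA
    nlinarith [sq_nonneg k, mul_pos hw0 (pow_pos hc₂ 2), mul_nonneg hw0.le (sq_nonneg k)]
  have hdF : d2F ρ f κ (σ * k) c₂ * Fk ρ f κ (σ * k) c₂
      = ∫ p, (p.2 * hinge κ (σ * k) 0 p - p.2 * hinge κ (σ * k) c₂ p) ∂labelMeasure ρ f := by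
    rw [integral_sub (integrable_snd_mul_hinge hf _ _ _) (integrable_snd_mul_hinge hf _ _ _),
      integral_snd_mul_hinge_zero hfc hf, d2F_eq hfc hf, div_mul_cancel₀ _ hF.ne', zero_sub]
  have hint := (integrable_snd_mul_hinge (ρ := ρ) hf κ (σ * k) 0).sub
    (integrable_snd_mul_hinge (ρ := ρ) hf κ (σ * k) c₂)
  refine ⟨by rw [hsq]; exact hA, ?_, ?_, ?_, ?_⟩
  · rw [Fk_sq hfc hf]
    calc ∫ p, hinge κ (σ * k) c₂ p ^ 2 ∂labelMeasure ρ f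
        ≤ ∫ p, 3 * (κ ^ 2 + (σ * k) ^ 2 + c₂ ^ 2) * quadEnvelope p ∂labelMeasure ρ f :=
          integral_mono (integrable_hinge_sq hf _ _ _) (hEnv.const_mul _)
            fun p => hinge_sq_le _ _ _ _
      _ = 3 * E * (κ ^ 2 + (σ * k) ^ 2 + c₂ ^ 2) := by rw [integral_const_mul]; ring
      _ ≤ _ := mul_le_mul_of_nonneg_right (by nlinarith) (by positivity)
  · rw [hdF]
    calc w * c₂ ≤ c₂ * ∫ p, quadrantSq σ p ∂labelMeasure ρ f := by
          rw [mul_comm]; exact mul_le_mul_of_nonneg_left hσw hc₂.le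
      _ = ∫ p, c₂ * quadrantSq σ p ∂labelMeasure ρ f := (integral_const_mul _ _).symm
      _ ≤ _ := integral_mono ((integrable_quadrantSq hf σ).const_mul _) hint
          fun p => quadrantSq_mul_le_snd_mul hκ hk hc₂.le p
  · rw [hdF]
    calc _ ≤ ∫ p, c₂ * p.2 ^ 2 ∂labelMeasure ρ f :=
          integral_mono hint (hsnd.const_mul _) fun p => snd_mul_hinge_sub_le hc₂.le p
      _ = c₂ * ∫ p, p.2 ^ 2 ∂labelMeasure ρ f := integral_const_mul _ _
      _ ≤ _ := by nlinarith
  · rw [d1F_eq hfc hf, abs_div, abs_neg, abs_of_pos hF, div_le_iff₀ hF]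
    set F := Fk ρ f κ (σ * k) c₂ with hFdef
    calc |∫ p, p.1 * hinge κ (σ * k) c₂ p ∂labelMeasure ρ f|
        ≤ ∫ p, |p.1 * hinge κ (σ * k) c₂ p| ∂labelMeasure ρ f := abs_integral_le_integral_abs
      _ ≤ ∫ p, (F * p.1 ^ 2 + F⁻¹ * hinge κ (σ * k) c₂ p ^ 2) ∂labelMeasure ρ f := by
          refine integral_mono (integrable_fst_mul_hinge hf _ _ _).abs
            ((hfst.const_mul _).add ((integrable_hinge_sq hf _ _ _).const_mul _)) fun p => ?_
          have h := mul_nonneg (inv_pos.2 hF).le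
            (sq_nonneg (F * |p.1| - hinge κ (σ * k) c₂ p))
          have h' : F⁻¹ * (F * |p.1| - hinge κ (σ * k) c₂ p) ^ 2 = F * p.1 ^ 2
              + F⁻¹ * hinge κ (σ * k) c₂ p ^ 2 - 2 * (|p.1| * hinge κ (σ * k) c₂ p) := by
            rw [← sq_abs p.1]; field_simp; ring
          change |p.1 * hinge κ (σ * k) c₂ p| ≤ F * p.1 ^ 2 + F⁻¹ * hinge κ (σ * k) c₂ p ^ 2
          rw [abs_mul, abs_of_nonneg (hinge_nonneg _ _ _ _)]
          nlinarith [mul_nonneg (abs_nonneg p.1) (hinge_nonneg κ (σ * k) c₂ p)]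
      _ = F * (∫ p, p.1 ^ 2 ∂labelMeasure ρ f) + F⁻¹ * F ^ 2 := by
          rw [integral_add (hfst.const_mul _) ((integrable_hinge_sq hf _ _ _).const_mul _),
            integral_const_mul, integral_const_mul, hFdef, Fk_sq hfc hf]
      _ ≤ _ := by
          have : F⁻¹ * F ^ 2 = F := by field_simp
          rw [this]
          nlinarith

/-- A directional derivative of `F_κ` is at most its recession function `F₀`. -/
lemma gradient_le_recession (hfc : Continuous f) (hf : ∀ t, f t ∈ Set.Icc (0 : ℝ) 1)
    {κ c₁ c₂ : ℝ} (a : ℝ) (hF : 0 < Fk ρ f κ c₁ c₂) (hF₀ : 0 < Fk ρ f 0 a 1) :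
    a * d1F ρ f κ c₁ c₂ + d2F ρ f κ c₁ c₂ ≤ Fk ρ f 0 a 1 := by
  set F := Fk ρ f κ c₁ c₂ with hFdef
  set F₀ := Fk ρ f 0 a 1 with hF₀def
  set t := F / F₀ with ht
  have ht0 : 0 < t := div_pos hF hF₀
  have hi1 := integrable_fst_mul_hinge (ρ := ρ) hf κ c₁ c₂
  have hi2 := integrable_snd_mul_hinge (ρ := ρ) hf κ c₁ c₂
  have hi3 := integrable_hinge_sq (ρ := ρ) hf κ c₁ c₂
  have hi4 := integrable_hinge_sq (ρ := ρ) hf 0 a 1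
  have key : -(a * ∫ p, p.1 * hinge κ c₁ c₂ p ∂labelMeasure ρ f)
      - ∫ p, p.2 * hinge κ c₁ c₂ p ∂labelMeasure ρ f ≤ F * F₀ := by
    calc _ = ∫ p, (-a * (p.1 * hinge κ c₁ c₂ p) - p.2 * hinge κ c₁ c₂ p)
            ∂labelMeasure ρ f := by
          rw [integral_sub (hi1.const_mul (-a)) hi2, integral_const_mul, neg_mul]
      _ ≤ ∫ p, (t / 2 * hinge 0 a 1 p ^ 2 + t⁻¹ / 2 * hinge κ c₁ c₂ p ^ 2)
            ∂labelMeasure ρ f := by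
          refine integral_mono ((hi1.const_mul (-a)).sub hi2)
            ((hi4.const_mul _).add (hi3.const_mul _)) fun p => ?_
          change -a * (p.1 * hinge κ c₁ c₂ p) - p.2 * hinge κ c₁ c₂ p
            ≤ t / 2 * hinge 0 a 1 p ^ 2 + t⁻¹ / 2 * hinge κ c₁ c₂ p ^ 2
          have h1 : -(a * p.1) - p.2 ≤ hinge 0 a 1 p := by
            refine le_trans (le_of_eq ?_) (le_max_left _ _); ring
          have h2 := mul_le_mul_of_nonneg_right h1 (hinge_nonneg κ c₁ c₂ p)
          have h3 := mul_nonneg (inv_pos.2 ht0).le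
            (sq_nonneg (t * hinge 0 a 1 p - hinge κ c₁ c₂ p))
          have h4 : t⁻¹ * (t * hinge 0 a 1 p - hinge κ c₁ c₂ p) ^ 2 = t * hinge 0 a 1 p ^ 2
              + t⁻¹ * hinge κ c₁ c₂ p ^ 2 - 2 * (hinge 0 a 1 p * hinge κ c₁ c₂ p) := by
            field_simp; ring
          linarith
      _ = t / 2 * F₀ ^ 2 + t⁻¹ / 2 * F ^ 2 := by
          rw [integral_add (hi4.const_mul _) (hi3.const_mul _), integral_const_mul,
            integral_const_mul, hFdef, hF₀def, Fk_sq hfc hf, Fk_sq hfc hf]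
      _ = F * F₀ := by rw [ht]; field_simp; ring
  rw [d1F_eq hfc hf, d2F_eq hfc hf, ← hFdef, mul_div_assoc', ← add_div, div_le_iff₀ hF]
  linarith

end LabelMeasure

/-! ### The soft-thresholded field -/

/-- Soft thresholding written so as to be jointly continuous in threshold and argument. -/
def soft (s t : ℝ) : ℝ := max (t - s) 0 - max (-t - s) 0

lemma prox_eq_soft {s : ℝ} (hs : 0 ≤ s) (t : ℝ) : prox s t = soft s t := by
  unfold prox soft
  rcases lt_trichotomy t 0 with h | h | h
  · rw [Real.sign_of_neg h, abs_of_neg h, max_eq_right (by linarith : t - s ≤ 0)]; ring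
  · subst h; simp
  · rw [Real.sign_of_pos h, abs_of_pos h, max_eq_right (by linarith : -t - s ≤ 0)]; ring

lemma soft_zero (t : ℝ) : soft 0 t = t := by
  unfold soft
  rcases le_total 0 t with h | h
  · rw [max_eq_left (by linarith), max_eq_right (by linarith)]; ring
  · rw [max_eq_right (by linarith), max_eq_left (by linarith)]; ring

lemma abs_soft_le (s t : ℝ) : |soft s t| ≤ 2 * |t| := by
  unfold soft
  refine (abs_max_sub_max_le_abs _ _ _).trans (le_of_eq ?_)
  rw [show t - s - (-t - s) = 2 * t by ring, abs_mul, abs_two]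

lemma mul_abs_soft_le {s : ℝ} (hs : 0 ≤ s) (t : ℝ) : s * |soft s t| ≤ t ^ 2 := by
  unfold soft
  rcases le_total s |t| with h | h
  · rcases le_total 0 t with h0 | h0
    · rw [abs_of_nonneg h0] at h
      rw [max_eq_left (by linarith), max_eq_right (by linarith), sub_zero,
        abs_of_nonneg (by linarith)]
      nlinarith [sq_nonneg (t - s)]
    · rw [abs_of_nonpos h0] at h
      rw [max_eq_right (by linarith), max_eq_left (by linarith), zero_sub, abs_neg,
        abs_of_nonneg (by linarith)]
      nlinarith [sq_nonneg (t + s)]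
  · have := abs_le.1 h
    rw [max_eq_right (by linarith), max_eq_right (by linarith)]
    simp [sq_nonneg]

/-- The field `Λ^{-1/2} 𝒯`, as a function of the drift coefficient `A` and the threshold `s`. -/
def field (A s : ℝ) (q : (ℝ × ℝ) × ℝ) : ℝ :=
  (√q.1.1)⁻¹ * soft s (√q.1.1 * q.2 + A * √q.1.1 * q.1.2)

/-- The correlation of the field with `W`. -/
def fieldCorr (μ : Measure (ℝ × ℝ)) (e : ℝ × ℝ) : ℝ :=
  ∫ q, q.1.2 * field e.1 e.2 q ∂(μ.prod _root_.stdGaussian)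

/-- The second moment of the field. -/
def fieldSq (μ : Measure (ℝ × ℝ)) (e : ℝ × ℝ) : ℝ :=
  ∫ q, field e.1 e.2 q ^ 2 ∂(μ.prod _root_.stdGaussian)

/-- The weighted first absolute moment of the field. -/
def fieldAbs (μ : Measure (ℝ × ℝ)) (e : ℝ × ℝ) : ℝ :=
  ∫ q, (√q.1.1)⁻¹ * |field e.1 e.2 q| ∂(μ.prod _root_.stdGaussian)

/-- The support constraint on `(Λ, W)`, read under the joint law of `(Λ, W, G)`. -/
def SupportedIn (μ : Measure (ℝ × ℝ)) (c C' : ℝ) : Prop :=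
  ∀ᵐ q ∂(μ.prod _root_.stdGaussian), c ≤ q.1.1 ∧ q.1.1 ≤ c⁻¹ ∧ |q.1.2| ≤ C'

section Field

variable {μ : Measure (ℝ × ℝ)} {c C' : ℝ}

lemma supportedIn_of_measure_eq_one [IsProbabilityMeasure μ]
    (hμ : μ {q : ℝ × ℝ | q.1 ∈ Set.Icc c c⁻¹ ∧ q.2 ∈ Set.Icc (-C') C'} = 1) :
    SupportedIn μ c C' := by
  have hm : MeasurableSet {q : ℝ × ℝ | q.1 ∈ Set.Icc c c⁻¹ ∧ q.2 ∈ Set.Icc (-C') C'} :=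
    (measurable_fst measurableSet_Icc).inter (measurable_snd measurableSet_Icc)
  have h := (prob_compl_eq_zero_iff hm).2 hμ
  have h' : ∀ᵐ q ∂μ, q.1 ∈ Set.Icc c c⁻¹ ∧ q.2 ∈ Set.Icc (-C') C' := h
  filter_upwards [Measure.quasiMeasurePreserving_fst.ae h'] with q hq
  exact ⟨hq.1.1, hq.1.2, abs_le.2 hq.2⟩

/-- Pointwise consequences of the support constraint. -/
lemma sqrt_bounds {l : ℝ} (hc : 0 < c) (h1 : c ≤ l) (h2 : l ≤ c⁻¹) :
    0 < √l ∧ √l ≤ (√c)⁻¹ ∧ (√l)⁻¹ ≤ (√c)⁻¹ := by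
  have hl : 0 < √l := Real.sqrt_pos.2 (hc.trans_le h1)
  refine ⟨hl, ?_, ?_⟩
  · rw [← Real.sqrt_inv]; exact Real.sqrt_le_sqrt h2
  · exact inv_anti₀ (Real.sqrt_pos.2 hc) (Real.sqrt_le_sqrt h1)

lemma measurable_field (A s : ℝ) : Measurable (field A s) := by
  unfold field soft
  fun_prop

lemma measurable_inv_sqrt_mul_abs_field (A s : ℝ) :
    Measurable fun q : (ℝ × ℝ) × ℝ => (√q.1.1)⁻¹ * |field A s q| :=
  Measurable.mul (by fun_prop) (measurable_field A s).norm

lemma continuous_field_param (q : (ℝ × ℝ) × ℝ) :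
    Continuous fun e : ℝ × ℝ => field e.1 e.2 q := by
  unfold field soft
  fun_prop

lemma abs_field_le {A s : ℝ} {q : (ℝ × ℝ) × ℝ} (hl : 0 < √q.1.1) (hw : |q.1.2| ≤ C') :
    |field A s q| ≤ 2 * (|q.2| + |A| * C') := by
  have h1 : |√q.1.1 * q.2 + A * √q.1.1 * q.1.2| ≤ √q.1.1 * (|q.2| + |A| * C') := by
    rw [show √q.1.1 * q.2 + A * √q.1.1 * q.1.2 = √q.1.1 * (q.2 + A * q.1.2) by ring, abs_mul,
      abs_of_pos hl]
    refine mul_le_mul_of_nonneg_left ((abs_add_le _ _).trans ?_) hl.le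
    rw [abs_mul]
    have := mul_le_mul_of_nonneg_left hw (abs_nonneg A)
    linarith
  have h2 := abs_soft_le s (√q.1.1 * q.2 + A * √q.1.1 * q.1.2)
  rw [field, abs_mul, abs_of_pos (inv_pos.2 hl)]
  calc (√q.1.1)⁻¹ * _ ≤ (√q.1.1)⁻¹ * (2 * (√q.1.1 * (|q.2| + |A| * C'))) :=
        mul_le_mul_of_nonneg_left (by linarith) (inv_pos.2 hl).le
    _ = _ := by field_simp

/-- The constant dominating the square of the field. -/
def fieldBound (C' : ℝ) (e : ℝ × ℝ) : ℝ := 9 + 8 * (e.1 ^ 2 * C' ^ 2)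

lemma field_sq_le {A s : ℝ} {q : (ℝ × ℝ) × ℝ} (hl : 0 < √q.1.1) (hw : |q.1.2| ≤ C') :
    field A s q ^ 2 ≤ fieldBound C' (A, s) * (1 + q.2 ^ 2) ∧
    |field A s q| ≤ fieldBound C' (A, s) * (1 + q.2 ^ 2) := by
  have h := abs_field_le (A := A) (s := s) hl hw
  have h1 : |field A s q| ^ 2 ≤ (2 * (|q.2| + |A| * C')) ^ 2 :=
    pow_le_pow_left₀ (abs_nonneg _) h 2
  have h2 : (2 * (|q.2| + |A| * C')) ^ 2 ≤ 8 * (q.2 ^ 2 + A ^ 2 * C' ^ 2) := by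
    rw [← sq_abs q.2, ← sq_abs A]
    nlinarith [sq_nonneg (|q.2| - |A| * C')]
  have h3 := mul_nonneg (mul_nonneg (sq_nonneg A) (sq_nonneg C')) (sq_nonneg q.2)
  have h4 := sq_nonneg q.2
  rw [sq_abs] at h1
  have h5 : field A s q ^ 2 + 1 ≤ fieldBound C' (A, s) * (1 + q.2 ^ 2) := by
    unfold fieldBound
    nlinarith
  refine ⟨by linarith, ?_⟩
  nlinarith [sq_abs (field A s q), sq_nonneg (|field A s q| - 1)]

lemma integrable_one_add_sq [IsProbabilityMeasure μ] :
    Integrable (fun q : (ℝ × ℝ) × ℝ => 1 + q.2 ^ 2) (μ.prod _root_.stdGaussian) :=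
  (integrable_const 1).add (integrable_sq_stdGauss.comp_snd _)

lemma continuous_fieldBound : Continuous (fieldBound C') := by
  unfold fieldBound; fun_prop

lemma ae_abs_corr_le (hμ : SupportedIn μ c C') (hc : 0 < c) :
    ∀ᵐ q ∂(μ.prod _root_.stdGaussian), ∀ e : ℝ × ℝ,
      |q.1.2 * field e.1 e.2 q| ≤ C' * (fieldBound C' e * (1 + q.2 ^ 2)) := by
  filter_upwards [hμ] with q hq e
  rw [abs_mul]
  exact mul_le_mul hq.2.2 (field_sq_le (sqrt_bounds hc hq.1 hq.2.1).1 hq.2.2).2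
    (abs_nonneg _) ((abs_nonneg _).trans hq.2.2)

lemma ae_abs_sq_le (hμ : SupportedIn μ c C') (hc : 0 < c) :
    ∀ᵐ q ∂(μ.prod _root_.stdGaussian), ∀ e : ℝ × ℝ,
      |field e.1 e.2 q ^ 2| ≤ 1 * (fieldBound C' e * (1 + q.2 ^ 2)) := by
  filter_upwards [hμ] with q hq e
  rw [abs_of_nonneg (sq_nonneg _), one_mul]
  exact (field_sq_le (sqrt_bounds hc hq.1 hq.2.1).1 hq.2.2).1

lemma ae_abs_abs_le (hμ : SupportedIn μ c C') (hc : 0 < c) :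
    ∀ᵐ q ∂(μ.prod _root_.stdGaussian), ∀ e : ℝ × ℝ,
      |(√q.1.1)⁻¹ * (|field e.1 e.2 q|)| ≤ (√c)⁻¹ * (fieldBound C' e * (1 + q.2 ^ 2)) := by
  filter_upwards [hμ] with q hq e
  have hl := sqrt_bounds hc hq.1 hq.2.1
  rw [abs_mul, abs_abs, abs_of_pos (inv_pos.2 hl.1)]
  exact mul_le_mul hl.2.2 (field_sq_le hl.1 hq.2.2).2 (abs_nonneg _) (by positivity)

lemma fieldAbs_nonneg (e : ℝ × ℝ) : 0 ≤ fieldAbs μ e :=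
  integral_nonneg fun _ => mul_nonneg (inv_nonneg.2 (Real.sqrt_nonneg _)) (abs_nonneg _)

lemma field_zero_ae (hμ : SupportedIn μ c C') (hc : 0 < c) (A : ℝ) :
    ∀ᵐ q ∂(μ.prod _root_.stdGaussian), field A 0 q = q.2 + A * q.1.2 := by
  filter_upwards [hμ] with q hq
  have hl := (sqrt_bounds hc hq.1 hq.2.1).1.ne'
  rw [field, soft_zero]
  field_simp

variable [IsProbabilityMeasure μ]

lemma continuous_of_abs_le_field {G : ℝ × ℝ → (ℝ × ℝ) × ℝ → ℝ} {K : ℝ}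
    (hG : ∀ e, Measurable (G e)) (hc : ∀ q, Continuous fun e => G e q)
    (hb : ∀ᵐ q ∂(μ.prod _root_.stdGaussian), ∀ e : ℝ × ℝ,
      |G e q| ≤ K * (fieldBound C' e * (1 + q.2 ^ 2))) :
    Continuous fun e => ∫ q, G e q ∂(μ.prod _root_.stdGaussian) := by
  refine continuous_integral_of_dominated_mul (k := fun e => K * fieldBound C' e)
    (fun e => (hG e).aestronglyMeasurable) hc (continuous_const.mul continuous_fieldBound)
    integrable_one_add_sq ?_
  filter_upwards [hb] with q hq
  exact ⟨by positivity, fun e => (hq e).trans_eq (by ring)⟩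

lemma integrable_of_abs_le_field {g : (ℝ × ℝ) × ℝ → ℝ} {K : ℝ} (hg : Measurable g)
    (hb : ∀ᵐ q ∂(μ.prod _root_.stdGaussian), |g q| ≤ K * (1 + q.2 ^ 2)) :
    Integrable g (μ.prod _root_.stdGaussian) :=
  (integrable_one_add_sq.const_mul K).mono' hg.aestronglyMeasurable hb

lemma continuous_fieldCorr (hμ : SupportedIn μ c C') (hc : 0 < c) : Continuous (fieldCorr μ) :=
  continuous_of_abs_le_field
    (fun _ => (measurable_snd.comp measurable_fst).mul (measurable_field _ _))
    (fun q => continuous_const.mul (continuous_field_param q)) (ae_abs_corr_le hμ hc)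

lemma continuous_fieldSq (hμ : SupportedIn μ c C') (hc : 0 < c) : Continuous (fieldSq μ) :=
  continuous_of_abs_le_field (fun _ => (measurable_field _ _).pow_const 2)
    (fun q => (continuous_field_param q).pow 2) (ae_abs_sq_le hμ hc)

lemma continuous_fieldAbs (hμ : SupportedIn μ c C') (hc : 0 < c) : Continuous (fieldAbs μ) :=
  continuous_of_abs_le_field (fun _ => measurable_inv_sqrt_mul_abs_field _ _)
    (fun q => continuous_const.mul (continuous_field_param q).abs) (ae_abs_abs_le hμ hc)

lemma integrable_corr (hμ : SupportedIn μ c C') (hc : 0 < c) (A s : ℝ) :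
    Integrable (fun q => q.1.2 * field A s q) (μ.prod _root_.stdGaussian) :=
  integrable_of_abs_le_field (K := C' * fieldBound C' (A, s))
    ((measurable_snd.comp measurable_fst).mul (measurable_field _ _)) <| by
    filter_upwards [ae_abs_corr_le hμ hc] with q hq
    exact (hq (A, s)).trans_eq (by ring)

lemma integrable_field_sq (hμ : SupportedIn μ c C') (hc : 0 < c) (A s : ℝ) :
    Integrable (fun q => field A s q ^ 2) (μ.prod _root_.stdGaussian) :=
  integrable_of_abs_le_field (K := fieldBound C' (A, s))
    ((measurable_field _ _).pow_const 2) <| by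
    filter_upwards [ae_abs_sq_le hμ hc] with q hq
    exact (hq (A, s)).trans_eq (by ring)

lemma integrable_abs_field (hμ : SupportedIn μ c C') (hc : 0 < c) (A s : ℝ) :
    Integrable (fun q => (√q.1.1)⁻¹ * |field A s q|) (μ.prod _root_.stdGaussian) :=
  integrable_of_abs_le_field (K := (√c)⁻¹ * fieldBound C' (A, s))
    (measurable_inv_sqrt_mul_abs_field _ _) <| by
    filter_upwards [ae_abs_abs_le hμ hc] with q hq
    exact (hq (A, s)).trans_eq (by ring)

lemma abs_fieldCorr_le (hμ : SupportedIn μ c C') (hc : 0 < c) (e : ℝ × ℝ) :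
    |fieldCorr μ e| ≤ C' * (√c)⁻¹ * fieldAbs μ e := by
  rw [fieldAbs, ← integral_const_mul]
  refine abs_integral_le_integral_abs.trans (integral_mono_ae (integrable_corr hμ hc _ _).abs
    ((integrable_abs_field hμ hc _ _).const_mul _) ?_)
  filter_upwards [hμ] with q hq
  have hl := sqrt_bounds hc hq.1 hq.2.1
  have hC : 0 ≤ C' := (abs_nonneg _).trans hq.2.2
  have h1 : 1 ≤ (√c)⁻¹ * (√q.1.1)⁻¹ := by
    calc (1 : ℝ) = √q.1.1 * (√q.1.1)⁻¹ := (mul_inv_cancel₀ hl.1.ne').symm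
      _ ≤ _ := mul_le_mul_of_nonneg_right hl.2.1 (inv_pos.2 hl.1).le
  rw [abs_mul]
  calc |q.1.2| * |field e.1 e.2 q| ≤ C' * |field e.1 e.2 q| :=
        mul_le_mul_of_nonneg_right hq.2.2 (abs_nonneg _)
    _ ≤ C' * ((√c)⁻¹ * (√q.1.1)⁻¹ * |field e.1 e.2 q|) :=
        mul_le_mul_of_nonneg_left (le_mul_of_one_le_left (abs_nonneg _) h1) hC
    _ = _ := by ring

/-- Uniformly over bounded drifts, the second moment of the field is controlled by its first
absolute moment. -/
lemma exists_fieldSq_le (hμ : SupportedIn μ c C') (hc : 0 < c) (A₀ : ℝ) :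
    ∃ M > 0, ∀ e : ℝ × ℝ, |e.1| ≤ A₀ → ∀ K > 0, fieldSq μ e ≤ K * fieldAbs μ e + M / K := by
  have ha : 0 < (√c)⁻¹ := inv_pos.2 (Real.sqrt_pos.2 hc)
  have hi3 : Integrable (fun q : (ℝ × ℝ) × ℝ => |q.2| ^ 3) (μ.prod _root_.stdGaussian) :=
    (integrable_abs_pow_stdGauss 3).comp_snd _
  have hi : Integrable (fun q : (ℝ × ℝ) × ℝ => (√c)⁻¹ * (32 * (|q.2| ^ 3 + |A₀ * C'| ^ 3)))
      (μ.prod _root_.stdGaussian) :=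
    ((hi3.add (integrable_const (|A₀ * C'| ^ 3))).const_mul 32).const_mul _
  set I := ∫ q : (ℝ × ℝ) × ℝ, (√c)⁻¹ * (32 * (|q.2| ^ 3 + |A₀ * C'| ^ 3))
    ∂(μ.prod _root_.stdGaussian) with hI
  have hI0 : 0 ≤ I := integral_nonneg fun q => by positivity
  refine ⟨I + 1, by linarith, fun e he K hK => ?_⟩
  calc fieldSq μ e
      ≤ ∫ q : (ℝ × ℝ) × ℝ, (K * ((√q.1.1)⁻¹ * |field e.1 e.2 q|)
          + K⁻¹ * ((√c)⁻¹ * (32 * (|q.2| ^ 3 + |A₀ * C'| ^ 3)))) ∂(μ.prod _root_.stdGaussian) := by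
        refine integral_mono_ae (integrable_field_sq hμ hc _ _)
          (((integrable_abs_field hμ hc _ _).const_mul _).add (hi.const_mul _)) ?_
        filter_upwards [hμ] with q hq
        have hl := sqrt_bounds hc hq.1 hq.2.1
        have hC : 0 ≤ C' := (abs_nonneg _).trans hq.2.2
        set x := |field e.1 e.2 q| with hx
        have hx0 : 0 ≤ x := abs_nonneg _
        have hxL : x ≤ 2 * (|q.2| + |A₀ * C'|) := by
          have h1 := abs_field_le (A := e.1) (s := e.2) hl.1 hq.2.2
          have h2 : |e.1| * C' ≤ |A₀ * C'| :=
            (mul_le_mul_of_nonneg_right he hC).trans (le_abs_self _)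
          linarith
        have hx3 : x ^ 3 ≤ 32 * (|q.2| ^ 3 + |A₀ * C'| ^ 3) := by
          refine (pow_le_pow_left₀ hx0 hxL 3).trans ?_
          have hu := abs_nonneg q.2
          have hv := abs_nonneg (A₀ * C')
          nlinarith [mul_nonneg (add_nonneg hu hv) (sq_nonneg (|q.2| - |A₀ * C'|))]
        have h1 : 1 ≤ (√c)⁻¹ * (√q.1.1)⁻¹ := by
          calc (1 : ℝ) = √q.1.1 * (√q.1.1)⁻¹ := (mul_inv_cancel₀ hl.1.ne').symm
            _ ≤ _ := mul_le_mul_of_nonneg_right hl.2.1 (inv_pos.2 hl.1).le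
        have hsx : field e.1 e.2 q ^ 2 = x ^ 2 := (sq_abs _).symm
        change field e.1 e.2 q ^ 2 ≤ K * ((√q.1.1)⁻¹ * x) + K⁻¹ * ((√c)⁻¹ * _)
        rw [hsx]
        have hl' := inv_pos.2 hl.1
        rcases le_total x (K * (√q.1.1)⁻¹) with h | h
        · have : x ^ 2 ≤ K * ((√q.1.1)⁻¹ * x) := by nlinarith
          have : 0 ≤ K⁻¹ * ((√c)⁻¹ * (32 * (|q.2| ^ 3 + |A₀ * C'| ^ 3))) := by positivity
          linarith
        · have h2 : x ^ 2 ≤ K⁻¹ * ((√c)⁻¹ * x ^ 3) := by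
            have h3 : K ≤ (√c)⁻¹ * x := by
              calc K ≤ K * ((√c)⁻¹ * (√q.1.1)⁻¹) := le_mul_of_one_le_right hK.le h1
                _ = (√c)⁻¹ * (K * (√q.1.1)⁻¹) := by ring
                _ ≤ _ := mul_le_mul_of_nonneg_left h ha.le
            calc x ^ 2 = K⁻¹ * (K * x ^ 2) := by field_simp
              _ ≤ K⁻¹ * ((√c)⁻¹ * x * x ^ 2) := by gcongr
              _ = _ := by ring
          have h4 : K⁻¹ * ((√c)⁻¹ * x ^ 3)
              ≤ K⁻¹ * ((√c)⁻¹ * (32 * (|q.2| ^ 3 + |A₀ * C'| ^ 3))) := by gcongr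
          have h5 : 0 ≤ K * ((√q.1.1)⁻¹ * x) := by positivity
          linarith
    _ = K * fieldAbs μ e + K⁻¹ * I := by
        rw [integral_add ((integrable_abs_field hμ hc _ _).const_mul _) (hi.const_mul _),
          integral_const_mul, integral_const_mul, hI, fieldAbs]
    _ ≤ K * fieldAbs μ e + (I + 1) / K := by
        rw [div_eq_inv_mul]
        have := inv_pos.2 hK
        nlinarith

/-- Uniformly over bounded drifts, the first absolute moment decays in the threshold. -/
lemma exists_mul_fieldAbs_le (hμ : SupportedIn μ c C') (hc : 0 < c) (A₀ : ℝ) :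
    ∃ M > 0, ∀ e : ℝ × ℝ, |e.1| ≤ A₀ → 0 ≤ e.2 → e.2 * fieldAbs μ e ≤ M := by
  have hi2 : Integrable (fun q : (ℝ × ℝ) × ℝ => q.2 ^ 2) (μ.prod _root_.stdGaussian) :=
    integrable_sq_stdGauss.comp_snd _
  have hi : Integrable (fun q : (ℝ × ℝ) × ℝ => 2 * (q.2 ^ 2 + (A₀ * C') ^ 2))
      (μ.prod _root_.stdGaussian) :=
    (hi2.add (integrable_const ((A₀ * C') ^ 2))).const_mul 2
  set I := ∫ q : (ℝ × ℝ) × ℝ, 2 * (q.2 ^ 2 + (A₀ * C') ^ 2) ∂(μ.prod _root_.stdGaussian) with hI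
  have hI0 : 0 ≤ I := integral_nonneg fun q => by positivity
  refine ⟨I + 1, by linarith, fun e he hs => ?_⟩
  rw [fieldAbs, ← integral_const_mul]
  refine le_trans (integral_mono_ae ((integrable_abs_field hμ hc _ _).const_mul _) hi ?_)
    (by linarith : I ≤ I + 1)
  filter_upwards [hμ] with q hq
  have hl := sqrt_bounds hc hq.1 hq.2.1
  have hC : 0 ≤ C' := (abs_nonneg _).trans hq.2.2
  have h := mul_abs_soft_le hs (√q.1.1 * q.2 + e.1 * √q.1.1 * q.1.2)
  have h2 : (e.1 * q.1.2) ^ 2 ≤ (A₀ * C') ^ 2 := by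
    rw [← sq_abs (e.1 * q.1.2), abs_mul]
    exact pow_le_pow_left₀ (by positivity)
      (mul_le_mul he hq.2.2 (abs_nonneg _) ((abs_nonneg _).trans he)) 2
  calc e.2 * ((√q.1.1)⁻¹ * |field e.1 e.2 q|)
      = (√q.1.1)⁻¹ ^ 2 * (e.2 * |soft e.2 (√q.1.1 * q.2 + e.1 * √q.1.1 * q.1.2)|) := by
        rw [field, abs_mul, abs_of_pos (inv_pos.2 hl.1)]; ring
    _ ≤ (√q.1.1)⁻¹ ^ 2 * (√q.1.1 * q.2 + e.1 * √q.1.1 * q.1.2) ^ 2 := by gcongr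
    _ = (q.2 + e.1 * q.1.2) ^ 2 := by have := hl.1.ne'; field_simp
    _ ≤ 2 * (q.2 ^ 2 + (A₀ * C') ^ 2) := by nlinarith [sq_nonneg (q.2 - e.1 * q.1.2)]

lemma integrable_w_sq (hμ : SupportedIn μ c C') :
    Integrable (fun q : (ℝ × ℝ) × ℝ => q.1.2 ^ 2) (μ.prod _root_.stdGaussian) := by
  refine integrable_of_abs_le_field (K := C' ^ 2) (by fun_prop) ?_
  filter_upwards [hμ] with q hq
  have h : |q.1.2| ^ 2 ≤ C' ^ 2 := pow_le_pow_left₀ (abs_nonneg _) hq.2.2 2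
  rw [abs_of_nonneg (sq_nonneg _), ← sq_abs]
  nlinarith [mul_nonneg (sq_nonneg C') (sq_nonneg q.2)]

lemma integral_w_sq (hm : ∫ q, q.2 ^ 2 ∂μ = 1) :
    ∫ q : (ℝ × ℝ) × ℝ, q.1.2 ^ 2 ∂(μ.prod _root_.stdGaussian) = 1 := by
  have h := integral_prod_mul (μ := μ) (ν := _root_.stdGaussian)
    (fun p : ℝ × ℝ => p.2 ^ 2) (fun _ : ℝ => (1 : ℝ))
  simpa [hm] using h

lemma integrable_w_mul_g (hμ : SupportedIn μ c C') :
    Integrable (fun q : (ℝ × ℝ) × ℝ => q.1.2 * q.2) (μ.prod _root_.stdGaussian) := by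
  refine integrable_of_abs_le_field (K := C') (by fun_prop) ?_
  filter_upwards [hμ] with q hq
  have hC : 0 ≤ C' := (abs_nonneg _).trans hq.2.2
  rw [abs_mul]
  have : |q.2| ≤ 1 + q.2 ^ 2 := by nlinarith [sq_abs q.2, sq_nonneg (|q.2| - 1)]
  exact mul_le_mul hq.2.2 this (abs_nonneg _) hC

lemma integral_w_mul_g :
    ∫ q : (ℝ × ℝ) × ℝ, q.1.2 * q.2 ∂(μ.prod _root_.stdGaussian) = 0 := by
  have h := integral_prod_mul (μ := μ) (ν := _root_.stdGaussian)
    (fun p : ℝ × ℝ => p.2) (fun z : ℝ => z)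
  rwa [integral_id_stdGauss, mul_zero] at h

lemma fieldCorr_zero (hμ : SupportedIn μ c C') (hc : 0 < c) (hm : ∫ q, q.2 ^ 2 ∂μ = 1) (A : ℝ) :
    fieldCorr μ (A, 0) = A := by
  calc fieldCorr μ (A, 0)
      = ∫ q : (ℝ × ℝ) × ℝ, (q.1.2 * q.2 + A * q.1.2 ^ 2) ∂(μ.prod _root_.stdGaussian) := by
        refine integral_congr_ae ?_
        filter_upwards [field_zero_ae hμ hc A] with q hq
        rw [hq]; ring
    _ = A := by
        rw [integral_add (integrable_w_mul_g hμ) ((integrable_w_sq hμ).const_mul _),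
          integral_const_mul, integral_w_mul_g, integral_w_sq hm]
        ring

lemma fieldSq_zero (hμ : SupportedIn μ c C') (hc : 0 < c) (hm : ∫ q, q.2 ^ 2 ∂μ = 1) (A : ℝ) :
    fieldSq μ (A, 0) = 1 + A ^ 2 := by
  have hi2 : Integrable (fun q : (ℝ × ℝ) × ℝ => q.2 ^ 2) (μ.prod _root_.stdGaussian) :=
    integrable_sq_stdGauss.comp_snd _
  have hg : ∫ q : (ℝ × ℝ) × ℝ, q.2 ^ 2 ∂(μ.prod _root_.stdGaussian) = 1 := by
    have h := integral_prod_mul (μ := μ) (ν := _root_.stdGaussian)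
      (fun _ : ℝ × ℝ => (1 : ℝ)) (fun z : ℝ => z ^ 2)
    simpa [integral_sq_stdGauss] using h
  have hi := integrable_w_mul_g hμ
  have hw := integrable_w_sq hμ
  have hs : Integrable (fun q : (ℝ × ℝ) × ℝ => 2 * A * (q.1.2 * q.2) + A ^ 2 * q.1.2 ^ 2)
      (μ.prod _root_.stdGaussian) := (hi.const_mul _).add (hw.const_mul _)
  calc fieldSq μ (A, 0)
      = ∫ q : (ℝ × ℝ) × ℝ, (q.2 ^ 2 + (2 * A * (q.1.2 * q.2) + A ^ 2 * q.1.2 ^ 2))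
          ∂(μ.prod _root_.stdGaussian) := by
        refine integral_congr_ae ?_
        filter_upwards [field_zero_ae hμ hc A] with q hq
        rw [hq]; ring
    _ = 1 + A ^ 2 := by
        rw [integral_add hi2 hs,
          integral_add (hi.const_mul _) (hw.const_mul _), integral_const_mul,
          integral_const_mul, integral_w_mul_g, integral_w_sq hm, hg]
        ring

/-- The field is not almost surely a multiple of `W`. -/
lemma field_not_collinear (hμ : SupportedIn μ c C') (hc : 0 < c) (hm : ∫ q, q.2 ^ 2 ∂μ = 1)
    {e : ℝ × ℝ} {B c₁ : ℝ} (hB : B ≠ 0) (h1 : c₁ + B * fieldCorr μ e = 0)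
    (h2 : c₁ ^ 2 = B ^ 2 * fieldSq μ e) : False := by
  have i1 := integrable_field_sq hμ hc e.1 e.2
  have i2 := integrable_corr hμ hc e.1 e.2
  have i3 := integrable_w_sq hμ
  have i4 : Integrable
      (fun q => 2 * B * c₁ * (q.1.2 * field e.1 e.2 q) + c₁ ^ 2 * q.1.2 ^ 2)
      (μ.prod _root_.stdGaussian) := (i2.const_mul _).add (i3.const_mul _)
  have hexp : ∀ q, (B * field e.1 e.2 q + c₁ * q.1.2) ^ 2 = B ^ 2 * field e.1 e.2 q ^ 2
      + (2 * B * c₁ * (q.1.2 * field e.1 e.2 q) + c₁ ^ 2 * q.1.2 ^ 2) := fun q => by ring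
  have hi : Integrable (fun q => (B * field e.1 e.2 q + c₁ * q.1.2) ^ 2)
      (μ.prod _root_.stdGaussian) := by
    simp only [hexp]
    exact (i1.const_mul _).add i4
  have h0 : ∫ q, (B * field e.1 e.2 q + c₁ * q.1.2) ^ 2 ∂(μ.prod _root_.stdGaussian) = 0 := by
    simp only [hexp]
    rw [integral_add (i1.const_mul _) i4,
      integral_add (i2.const_mul _) (i3.const_mul _), integral_const_mul, integral_const_mul,
      integral_const_mul, integral_w_sq hm]
    change B ^ 2 * fieldSq μ e + (2 * B * c₁ * fieldCorr μ e + c₁ ^ 2 * 1) = 0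
    rw [← h2]
    linear_combination 2 * c₁ * h1
  rw [integral_eq_zero_iff_of_nonneg (fun _ => sq_nonneg _) hi] at h0
  obtain ⟨p, hp, hp'⟩ := ((Measure.ae_ae_of_ae_prod h0).and
    (Measure.ae_ae_of_ae_prod hμ)).exists
  obtain ⟨_, hg⟩ := hp'.exists
  have hl := (sqrt_bounds hc hg.1 hg.2.1).1
  have hcont : Continuous fun z : ℝ => (B * field e.1 e.2 (p, z) + c₁ * p.2) ^ 2 := by
    have hs : Continuous (soft e.2) := by unfold soft; fun_prop
    have ht : Continuous fun z : ℝ => √p.1 * z + e.1 * √p.1 * p.2 := by fun_prop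
    have hf : Continuous fun z : ℝ => field e.1 e.2 (p, z) := (hs.comp ht).const_mul (√p.1)⁻¹
    fun_prop
  have hz : (fun z : ℝ => (B * field e.1 e.2 (p, z) + c₁ * p.2) ^ 2) = fun _ => 0 :=
    (hcont.ae_eq_iff_eq _root_.stdGaussian continuous_const).1 hp
  have hval : ∀ t : ℝ, |e.2| < t → B * ((√p.1)⁻¹ * (t - e.2)) + c₁ * p.2 = 0 := fun t ht => by
    have h := congrFun hz ((√p.1)⁻¹ * t - e.1 * p.2)
    have harg : √p.1 * ((√p.1)⁻¹ * t - e.1 * p.2) + e.1 * √p.1 * p.2 = t := by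
      field_simp; ring
    have hs := abs_lt.1 ht
    have hs' : soft e.2 t = t - e.2 := by
      unfold soft
      rw [max_eq_left (by linarith), max_eq_right (by linarith), sub_zero]
    simp only [field, harg, hs'] at h
    exact pow_eq_zero_iff two_ne_zero |>.1 h
  have ha := hval (|e.2| + 1) (by linarith)
  have hb := hval (|e.2| + 2) (by linarith)
  have : B * (√p.1)⁻¹ = 0 := by linear_combination hb - ha
  exact mul_ne_zero hB (inv_pos.2 hl).ne' this

end Field

/-! ### The nonlinear system in terms of the field -/

section System

variable {ρ ψ κ c C' : ℝ} {f : ℝ → ℝ} {μ : Measure (ℝ × ℝ)}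

lemma Fk_pos (hfc : Continuous f) (hf : ∀ t, f t ∈ Set.Icc (0 : ℝ) 1) (hκ : 0 ≤ κ) {c₁ c₂ : ℝ}
    (hc₂ : 0 < c₂) : 0 < Fk ρ f κ c₁ c₂ := by
  obtain ⟨q, hq, C, -, h⟩ := exists_margin_bounds (ρ := ρ) hfc hf
  have h1 : 0 < Fk ρ f κ c₁ c₂ ^ 2 := lt_of_lt_of_le (by positivity) (h κ c₁ c₂ hκ hc₂).1
  exact (Real.sqrt_nonneg _).lt_of_ne' (pow_ne_zero_iff two_ne_zero |>.1 h1.ne')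

lemma d2F_pos (hfc : Continuous f) (hf : ∀ t, f t ∈ Set.Icc (0 : ℝ) 1) (hκ : 0 ≤ κ) {c₁ c₂ : ℝ}
    (hc₂ : 0 < c₂) : 0 < d2F ρ f κ c₁ c₂ := by
  obtain ⟨q, hq, C, -, h⟩ := exists_margin_bounds (ρ := ρ) hfc hf
  have h1 : 0 < d2F ρ f κ c₁ c₂ * Fk ρ f κ c₁ c₂ :=
    lt_of_lt_of_le (by positivity) (h κ c₁ c₂ hκ hc₂).2.2.1
  exact pos_of_mul_pos_left h1 (Fk_pos hfc hf hκ hc₂).le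

lemma Dval_pos (hfc : Continuous f) (hf : ∀ t, f t ∈ Set.Icc (0 : ℝ) 1) (hκ : 0 ≤ κ) (hψ : 0 < ψ)
    {c₁ c₂ : ℝ} (hc₂ : 0 < c₂) : 0 < Dval ρ f ψ κ c₁ c₂ := by
  have := d2F_pos (ρ := ρ) hfc hf hκ hc₂ (c₁ := c₁)
  have := Real.sqrt_pos.2 hψ
  unfold Dval
  positivity

/-- The coefficient of `Λ^{1/2} W` in the argument of the proximal operator. -/
def drift (ρ : ℝ) (f : ℝ → ℝ) (ψ κ c₁ c₂ : ℝ) : ℝ :=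
  (√ψ)⁻¹ * (d1F ρ f κ c₁ c₂ - c₁ * c₂⁻¹ * d2F ρ f κ c₁ c₂)

lemma inv_sqrt_mul_Tcal {s : ℝ} (hs : 0 ≤ s) (c₁ c₂ : ℝ) (q : (ℝ × ℝ) × ℝ) :
    (√q.1.1)⁻¹ * Tcal ρ f ψ κ c₁ c₂ s q = field (drift ρ f ψ κ c₁ c₂) s q := by
  rw [Tcal, prox_eq_soft hs, field, drift]

lemma V1_eq {s : ℝ} (hs : 0 ≤ s) (c₁ c₂ : ℝ) :
    V1 ρ f ψ κ μ c₁ c₂ s =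
      c₁ + (Dval ρ f ψ κ c₁ c₂)⁻¹ * fieldCorr μ (drift ρ f ψ κ c₁ c₂, s) := by
  rw [V1, fieldCorr, ← integral_const_mul]
  congr 2
  ext q
  rw [← inv_sqrt_mul_Tcal hs]
  ring

lemma V2_eq {s : ℝ} (hs : 0 ≤ s) (c₁ c₂ : ℝ) :
    V2 ρ f ψ κ μ c₁ c₂ s = c₁ ^ 2 + c₂ ^ 2 -
      (Dval ρ f ψ κ c₁ c₂)⁻¹ ^ 2 * fieldSq μ (drift ρ f ψ κ c₁ c₂, s) := by
  rw [V2, fieldSq, ← integral_const_mul]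
  congr 2
  ext q
  rw [← inv_sqrt_mul_Tcal hs]
  ring

lemma V3_eq (hμ : SupportedIn μ c C') (hc : 0 < c) {s : ℝ} (hs : 0 ≤ s) {c₁ c₂ : ℝ}
    (hD : 0 < Dval ρ f ψ κ c₁ c₂) :
    V3 ρ f ψ κ μ c₁ c₂ s =
      1 - (Dval ρ f ψ κ c₁ c₂)⁻¹ * fieldAbs μ (drift ρ f ψ κ c₁ c₂, s) := by
  rw [V3, fieldAbs, ← integral_const_mul]
  congr 1
  refine integral_congr_ae ?_
  filter_upwards [hμ] with q hq
  have hl := (sqrt_bounds hc hq.1 hq.2.1).1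
  have hl2 : q.1.1⁻¹ = (√q.1.1)⁻¹ * (√q.1.1)⁻¹ := by
    rw [← mul_inv, Real.mul_self_sqrt (hc.le.trans hq.1)]
  rw [← inv_sqrt_mul_Tcal hs, hl2, abs_div, abs_of_pos hD, abs_mul, abs_mul, abs_mul,
    abs_of_pos (inv_pos.2 hl)]
  ring

lemma solvesSystem_of_eq_zero {c₁ c₂ s : ℝ} (h1 : V1 ρ f ψ κ μ c₁ c₂ s = 0)
    (h2 : V2 ρ f ψ κ μ c₁ c₂ s = 0) (h3 : V3 ρ f ψ κ μ c₁ c₂ s = 0) :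
    SolvesSystem ρ f ψ κ μ c₁ c₂ s :=
  ⟨eq_neg_of_add_eq_zero_left h1, sub_eq_zero.1 h2, sub_eq_zero.1 h3⟩

/-- The growth comparison bounding the second coordinate of an approximate solution. -/
lemma le_of_quadratic_bounds {x b M K δ B H2 H3 : ℝ} (hx : 0 < x) (hb : 0 < b) (hM : 0 < M)
    (hB0 : 0 ≤ B) (hH3 : 0 ≤ H3) (hK : K = 4 * b ^ 2 * M)
    (hδK : δ * (4 * (1 + K * b)) ≤ 1) (hBH3 : B * H3 ≤ 1 + δ * x) (hB : B ≤ b * x)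
    (e1 : x ^ 2 ≤ δ * x ^ 2 + B ^ 2 * H2) (hH2 : H2 ≤ K * H3 + M / K) : x ≤ 2 * K * b := by
  have hK0 : 0 < K := by rw [hK]; positivity
  have e2 : B ^ 2 * H2 ≤ B * (K * (B * H3)) + B ^ 2 * (M / K) := by
    calc B ^ 2 * H2 ≤ B ^ 2 * (K * H3 + M / K) := mul_le_mul_of_nonneg_left hH2 (sq_nonneg B)
      _ = _ := by ring
  have e3 : B * (K * (B * H3)) ≤ b * x * (K * (1 + δ * x)) := by
    have : 0 ≤ B * H3 := by positivity
    gcongr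
  have e4 : B ^ 2 * (M / K) ≤ x ^ 2 / 4 := by
    calc B ^ 2 * (M / K) ≤ (b * x) ^ 2 * (M / K) := by gcongr
      _ = x ^ 2 / 4 := by rw [hK]; field_simp
  have e5 : δ * (1 + K * b) * x ^ 2 ≤ 1 / 4 * x ^ 2 :=
    mul_le_mul_of_nonneg_right (by linarith) (sq_nonneg _)
  have e6 : x * (x / 2) ≤ x * (K * b) := by linarith
  have e7 := le_of_mul_le_mul_left e6 hx
  linarith

/-- The drift is uniformly bounded, and `1 / D` grows at most linearly. -/
lemma exists_drift_bounds (hfc : Continuous f) (hf : ∀ t, f t ∈ Set.Icc (0 : ℝ) 1) (hκ : 0 ≤ κ)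
    (hψ : 0 < ψ) :
    ∃ A₀, ∃ b > 0, ∀ c₁ c₂ : ℝ, 0 < c₂ → |drift ρ f ψ κ c₁ c₂| ≤ A₀ ∧
      (Dval ρ f ψ κ c₁ c₂)⁻¹ ≤ b * (κ + |c₁| + c₂) := by
  obtain ⟨q, hq, C, hC, h⟩ := exists_margin_bounds (ρ := ρ) hfc hf
  have hp := Real.sqrt_pos.2 hψ
  refine ⟨(√ψ)⁻¹ * (C + q⁻¹ * C), √ψ * C / q ^ 2, by positivity, fun c₁ c₂ hc₂ => ?_⟩
  obtain ⟨h1, h2, h3, h4, h5⟩ := h κ c₁ c₂ hκ hc₂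
  have hF := Fk_pos (ρ := ρ) hfc hf hκ hc₂ (c₁ := c₁)
  have hd := d2F_pos (ρ := ρ) hfc hf hκ hc₂ (c₁ := c₁)
  set F := Fk ρ f κ c₁ c₂
  set d := d2F ρ f κ c₁ c₂
  constructor
  · have hc₁ : q * |c₁| ≤ F := by
      refine (sq_le_sq₀ (by positivity) hF.le).1 ?_
      rw [mul_pow, sq_abs]
      nlinarith [mul_nonneg (sq_nonneg q) (sq_nonneg c₂)]
    have h6 : c₂⁻¹ * d ≤ C / F := by
      rw [inv_mul_le_iff₀ hc₂, ← mul_div_assoc, le_div_iff₀ hF]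
      linarith
    have h7 : |c₁| ≤ q⁻¹ * F := by rwa [le_inv_mul_iff₀ hq]
    have h8 : |c₁ * c₂⁻¹ * d| ≤ q⁻¹ * C := by
      rw [mul_assoc, abs_mul, abs_of_pos (by positivity : 0 < c₂⁻¹ * d)]
      calc |c₁| * (c₂⁻¹ * d) ≤ q⁻¹ * F * (C / F) :=
            mul_le_mul h7 h6 (by positivity) (by positivity)
        _ = q⁻¹ * C := by field_simp
    rw [drift, abs_mul, abs_of_pos (inv_pos.2 hp)]
    exact mul_le_mul_of_nonneg_left ((abs_sub _ _).trans (add_le_add h5 h8)) (inv_pos.2 hp).le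
  · have hF' : F ≤ C * (κ + |c₁| + c₂) := by
      refine (sq_le_sq₀ hF.le (by positivity)).1 (h2.trans ?_)
      rw [mul_pow, ← sq_abs c₁]
      have := abs_nonneg c₁
      gcongr
      nlinarith [mul_nonneg hκ this, mul_nonneg hκ hc₂.le, mul_nonneg this hc₂.le]
    have h6 : (Dval ρ f ψ κ c₁ c₂)⁻¹ = √ψ * (c₂ / d) := by
      change ((√ψ)⁻¹ * c₂⁻¹ * d)⁻¹ = _
      field_simp
    have h7 : c₂ / d ≤ F / q ^ 2 := by
      rw [div_le_div_iff₀ hd (by positivity)]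
      linarith
    rw [h6]
    calc √ψ * (c₂ / d) ≤ √ψ * (C * (κ + |c₁| + c₂) / q ^ 2) :=
          mul_le_mul_of_nonneg_left (h7.trans (by gcongr)) hp.le
      _ = _ := by ring

variable [IsProbabilityMeasure μ]

/-- Approximate solutions stay in a bounded region. -/
lemma exists_bound_of_approx (hfc : Continuous f) (hf : ∀ t, f t ∈ Set.Icc (0 : ℝ) 1)
    (hμ : SupportedIn μ c C') (hc : 0 < c) (hC' : 0 ≤ C') (hκ : 0 ≤ κ) (hψ : 0 < ψ) :
    ∃ δ > 0, ∃ R : ℝ, ∀ c₁ c₂ s : ℝ, 0 < c₂ → 0 < s →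
      |V1 ρ f ψ κ μ c₁ c₂ s| ≤ δ * max c₂ 1 →
      |V2 ρ f ψ κ μ c₁ c₂ s| ≤ δ * (max c₂ 1) ^ 2 →
      |V3 ρ f ψ κ μ c₁ c₂ s| ≤ δ * max c₂ 1 →
      |c₁| ≤ R ∧ |c₂| ≤ R ∧ |s| ≤ R ∧ |drift ρ f ψ κ c₁ c₂| ≤ R ∧
        |(Dval ρ f ψ κ c₁ c₂)⁻¹| ≤ R := by
  obtain ⟨A₀, b₀, hb₀, hA⟩ := exists_drift_bounds (ρ := ρ) hfc hf hκ hψ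
  obtain ⟨M, hM, hH2⟩ := exists_fieldSq_le hμ hc A₀
  obtain ⟨M', hM', hH3⟩ := exists_mul_fieldAbs_le hμ hc A₀
  set C₁ := C' * (√c)⁻¹ with hC₁
  have hC₁0 : 0 ≤ C₁ := by positivity
  set b := b₀ * (κ + (1 + 2 * C₁) + 1) with hb
  have hb0 : 0 < b := by positivity
  set K := 4 * b ^ 2 * M with hK
  have hK0 : 0 < K := by positivity
  set m₀ := 1 + 2 * K * b with hm₀
  have hm₀1 : 1 ≤ m₀ := by rw [hm₀]; linarith [mul_pos hK0 hb0]
  set δ := min (1 / (4 * (1 + K * b))) (1 / (2 * m₀)) with hδ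
  have hδ0 : 0 < δ := by positivity
  have hδ1 : δ * (4 * (1 + K * b)) ≤ 1 := by
    rw [← le_div_iff₀ (by positivity)]; exact min_le_left _ _
  have hδ2 : δ * (2 * m₀) ≤ 1 := by
    rw [← le_div_iff₀ (by positivity)]; exact min_le_right _ _
  have hδ3 : δ ≤ 1 := by linarith [mul_le_mul_of_nonneg_left hm₀1 hδ0.le]
  refine ⟨δ, hδ0, (1 + 2 * C₁) * m₀ + m₀ + 2 * (b * m₀ * M') + |A₀| + b * m₀, ?_⟩
  intro c₁ c₂ s hc₂ hs h1 h2 h3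
  have hD := Dval_pos (ρ := ρ) (c₁ := c₁) hfc hf hκ hψ hc₂
  rw [V1_eq hs.le] at h1
  rw [V2_eq hs.le] at h2
  rw [V3_eq hμ hc hs.le hD] at h3
  obtain ⟨hA1, hB1⟩ := hA c₁ c₂ hc₂
  have hH2' := hH2 (drift ρ f ψ κ c₁ c₂, s) hA1 K hK0
  have hH3' := hH3 (drift ρ f ψ κ c₁ c₂, s) hA1 hs.le
  have hH1' := abs_fieldCorr_le hμ hc (drift ρ f ψ κ c₁ c₂, s)
  have hH3n := fieldAbs_nonneg (μ := μ) (drift ρ f ψ κ c₁ c₂, s)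
  have hB0 := inv_pos.2 hD
  set A := drift ρ f ψ κ c₁ c₂
  set B := (Dval ρ f ψ κ c₁ c₂)⁻¹
  set H1 := fieldCorr μ (A, s)
  set H2 := fieldSq μ (A, s)
  set H3 := fieldAbs μ (A, s)
  set m := max c₂ 1 with hm
  have hm1 : 1 ≤ m := le_max_right _ _
  have hmc : c₂ ≤ m := le_max_left _ _
  clear_value C₁ b K m₀ δ A B H1 H2 H3 m
  have hBH3 : B * H3 ≤ 1 + δ * m := by linarith [(abs_le.1 h3).1]
  have hδm : δ * m ≤ m := mul_le_of_le_one_left (by linarith) hδ3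
  have hc₁ : |c₁| ≤ (1 + 2 * C₁) * m := by
    have e1 : |c₁| ≤ |c₁ + B * H1| + B * |H1| := by
      have := abs_sub (c₁ + B * H1) (B * H1)
      rwa [add_sub_cancel_right, abs_mul B, abs_of_pos hB0] at this
    have e2 : B * |H1| ≤ C₁ * (B * H3) := by
      calc B * |H1| ≤ B * (C₁ * H3) := mul_le_mul_of_nonneg_left (hH1'.trans_eq (by rw [hC₁])) hB0.le
        _ = _ := by ring
    have e3 : C₁ * (B * H3) ≤ C₁ * (2 * m) := mul_le_mul_of_nonneg_left (by linarith) hC₁0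
    linarith
  have hBm : B ≤ b * m := by
    refine hB1.trans ?_
    rw [hb, mul_assoc]
    refine mul_le_mul_of_nonneg_left ?_ hb₀.le
    linarith [mul_le_mul_of_nonneg_left hm1 hκ]
  have hmm : m ≤ m₀ := by
    rw [hm]
    refine max_le ?_ hm₀1
    by_contra! hlt
    have hmeq : m = c₂ := hm.trans (max_eq_left (by linarith))
    rw [hmeq] at hBH3 hBm h2
    have e1 : c₂ ^ 2 ≤ δ * c₂ ^ 2 + B ^ 2 * H2 := by
      linarith [(abs_le.1 h2).2, sq_nonneg c₁]
    have := le_of_quadratic_bounds hc₂ hb0 hM hB0.le hH3n hK hδ1 hBH3 hBm e1 hH2'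
    linarith
  have hBm₀ : B ≤ b * m₀ := hBm.trans (mul_le_mul_of_nonneg_left hmm hb0.le)
  have hs' : s ≤ 2 * (b * m₀ * M') := by
    have e1 : δ * m ≤ 1 / 2 := by linarith [mul_le_mul_of_nonneg_left hmm hδ0.le]
    have e2 : 1 / 2 ≤ B * H3 := by linarith [(abs_le.1 h3).2]
    have e3 : s * (1 / 2) ≤ b * m₀ * M' := by
      calc s * (1 / 2) ≤ s * (B * H3) := mul_le_mul_of_nonneg_left e2 hs.le
        _ = B * (s * H3) := by ring
        _ ≤ b * m₀ * M' := mul_le_mul hBm₀ hH3' (by positivity) (by positivity)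
    linarith
  have hc₁' : |c₁| ≤ (1 + 2 * C₁) * m₀ :=
    hc₁.trans (mul_le_mul_of_nonneg_left hmm (by positivity))
  have hA0 := le_abs_self A₀
  have p1 : 0 ≤ (1 + 2 * C₁) * m₀ := by positivity
  have p2 : 0 ≤ b * m₀ := by positivity
  have p3 : 0 ≤ b * m₀ * M' := by positivity
  have p4 := abs_nonneg A₀
  rw [abs_of_pos hc₂, abs_of_pos hs, abs_of_pos hB0]
  refine ⟨?_, ?_, ?_, ?_, ?_⟩ <;> linarith

/-- A solution of the system with vanishing threshold forces `ψ ≤ ψ*`. -/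
lemma le_psiSep_of_threshold_zero (hfc : Continuous f) (hf : ∀ t, f t ∈ Set.Icc (0 : ℝ) 1)
    (hμ : SupportedIn μ c C') (hc : 0 < c) (hm : ∫ q, q.2 ^ 2 ∂μ = 1) (hκ : 0 ≤ κ) (hψ : 0 < ψ)
    {c₁ c₂ : ℝ} (hc₂ : 0 < c₂) (h1 : V1 ρ f ψ κ μ c₁ c₂ 0 = 0) (h2 : V2 ρ f ψ κ μ c₁ c₂ 0 = 0) :
    ψ ≤ psiSep ρ f := by
  have hp := Real.sqrt_pos.2 hψ
  have hD := Dval_pos (ρ := ρ) (c₁ := c₁) hfc hf hκ hψ hc₂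
  rw [V1_eq le_rfl, fieldCorr_zero hμ hc hm] at h1
  rw [V2_eq le_rfl, fieldSq_zero hμ hc hm] at h2
  have hB0 := inv_pos.2 hD
  have hc₂B : c₂ = (Dval ρ f ψ κ c₁ c₂)⁻¹ := by
    refine (sq_eq_sq₀ hc₂.le hB0.le).1 ?_
    linear_combination h2 - (c₁ - (Dval ρ f ψ κ c₁ c₂)⁻¹ * drift ρ f ψ κ c₁ c₂) * h1
  have hd2 : d2F ρ f κ c₁ c₂ = √ψ := by
    have h := mul_inv_cancel₀ hD.ne'
    rw [← hc₂B, Dval] at h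
    field_simp at h
    linarith
  have hd1 : d1F ρ f κ c₁ c₂ = 0 := by
    rw [← hc₂B, drift, hd2] at h1
    field_simp at h1
    have h3 : c₂ * d1F ρ f κ c₁ c₂ = 0 := by linarith
    exact (mul_eq_zero.1 h3).resolve_left hc₂.ne'
  refine le_ciInf fun a => ?_
  have h := gradient_le_recession hfc hf a (Fk_pos (ρ := ρ) (c₁ := c₁) hfc hf hκ hc₂)
    (Fk_pos hfc hf le_rfl one_pos)
  rw [hd1, hd2, mul_zero, zero_add] at h
  rw [← Real.sq_sqrt hψ.le]
  exact pow_le_pow_left₀ hp.le h 2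

/-- The drift is continuous away from `c₂ = 0`. -/
lemma tendsto_drift (hfc : Continuous f) (hf : ∀ t, f t ∈ Set.Icc (0 : ℝ) 1) (hκ : 0 ≤ κ)
    {u₁ u₂ : ℕ → ℝ} {c₁ c₂ : ℝ} (hc₂ : 0 < c₂) (h₁ : Tendsto u₁ atTop (𝓝 c₁))
    (h₂ : Tendsto u₂ atTop (𝓝 c₂)) :
    Tendsto (fun n => drift ρ f ψ κ (u₁ n) (u₂ n)) atTop (𝓝 (drift ρ f ψ κ c₁ c₂)) := by
  have hF := Fk_pos (ρ := ρ) (c₁ := c₁) hfc hf hκ hc₂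
  have hp := h₁.prodMk_nhds h₂
  have k1 := (continuousAt_d1F (c := (c₁, c₂)) hfc hf κ hF).tendsto.comp hp
  have k2 := (continuousAt_d2F (c := (c₁, c₂)) hfc hf κ hF).tendsto.comp hp
  exact (k1.sub ((h₁.mul (h₂.inv₀ hc₂.ne')).mul k2)).const_mul _

/-- The denominator is continuous away from `c₂ = 0`. -/
lemma tendsto_Dval (hfc : Continuous f) (hf : ∀ t, f t ∈ Set.Icc (0 : ℝ) 1) (hκ : 0 ≤ κ)
    {u₁ u₂ : ℕ → ℝ} {c₁ c₂ : ℝ} (hc₂ : 0 < c₂) (h₁ : Tendsto u₁ atTop (𝓝 c₁))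
    (h₂ : Tendsto u₂ atTop (𝓝 c₂)) :
    Tendsto (fun n => Dval ρ f ψ κ (u₁ n) (u₂ n)) atTop (𝓝 (Dval ρ f ψ κ c₁ c₂)) := by
  have hF := Fk_pos (ρ := ρ) (c₁ := c₁) hfc hf hκ hc₂
  have k2 := (continuousAt_d2F (c := (c₁, c₂)) hfc hf κ hF).tendsto.comp (h₁.prodMk_nhds h₂)
  exact ((h₂.inv₀ hc₂.ne').const_mul _).mul k2

/-- Limits of approximate solutions solve the system. -/
lemma solvesSystem_of_tendsto (hfc : Continuous f) (hf : ∀ t, f t ∈ Set.Icc (0 : ℝ) 1)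
    (hμ : SupportedIn μ c C') (hc : 0 < c) (hm : ∫ q, q.2 ^ 2 ∂μ = 1) (hκ : 0 ≤ κ) (hψ : 0 < ψ)
    (hsep : psiSep ρ f < ψ) {u₁ u₂ v : ℕ → ℝ} {c₁ c₂ s A B : ℝ} (hu₂ : ∀ n, 0 < u₂ n)
    (hv : ∀ n, 0 < v n) (hc₁ : Tendsto u₁ atTop (𝓝 c₁)) (hc₂ : Tendsto u₂ atTop (𝓝 c₂))
    (hs : Tendsto v atTop (𝓝 s))
    (hA : Tendsto (fun n => drift ρ f ψ κ (u₁ n) (u₂ n)) atTop (𝓝 A))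
    (hB : Tendsto (fun n => (Dval ρ f ψ κ (u₁ n) (u₂ n))⁻¹) atTop (𝓝 B))
    (h1 : Tendsto (fun n => V1 ρ f ψ κ μ (u₁ n) (u₂ n) (v n)) atTop (𝓝 0))
    (h2 : Tendsto (fun n => V2 ρ f ψ κ μ (u₁ n) (u₂ n) (v n)) atTop (𝓝 0))
    (h3 : Tendsto (fun n => V3 ρ f ψ κ μ (u₁ n) (u₂ n) (v n)) atTop (𝓝 0)) :
    0 < c₂ ∧ 0 < s ∧ SolvesSystem ρ f ψ κ μ c₁ c₂ s := by
  have hD n := Dval_pos (ρ := ρ) (c₁ := u₁ n) hfc hf hκ hψ (hu₂ n)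
  have hAs := hA.prodMk_nhds hs
  have k1 := ((continuous_fieldCorr hμ hc).tendsto (A, s)).comp hAs
  have k2 := ((continuous_fieldSq hμ hc).tendsto (A, s)).comp hAs
  have k3 := ((continuous_fieldAbs hμ hc).tendsto (A, s)).comp hAs
  have l1 : 0 = c₁ + B * fieldCorr μ (A, s) :=
    tendsto_nhds_unique (h1.congr fun n => V1_eq (hv n).le _ _) (hc₁.add (hB.mul k1))
  have l2 : 0 = c₁ ^ 2 + c₂ ^ 2 - B ^ 2 * fieldSq μ (A, s) :=
    tendsto_nhds_unique (h2.congr fun n => V2_eq (hv n).le _ _)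
      (((hc₁.pow 2).add (hc₂.pow 2)).sub ((hB.pow 2).mul k2))
  have l3 : 0 = 1 - B * fieldAbs μ (A, s) :=
    tendsto_nhds_unique (h3.congr fun n => V3_eq hμ hc (hv n).le (hD n))
      (tendsto_const_nhds.sub (hB.mul k3))
  have hB0 : B ≠ 0 := by rintro rfl; norm_num at l3
  have hc₂0 : 0 < c₂ := by
    refine (ge_of_tendsto' hc₂ fun n => (hu₂ n).le).lt_of_ne' fun h0 => ?_
    refine field_not_collinear hμ hc hm hB0 l1.symm ?_
    rw [h0] at l2
    linear_combination -l2
  have hs0 : 0 ≤ s := ge_of_tendsto' hs fun n => (hv n).le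
  have hD0 := Dval_pos (ρ := ρ) (c₁ := c₁) hfc hf hκ hψ hc₂0
  have eA : A = drift ρ f ψ κ c₁ c₂ := tendsto_nhds_unique hA (tendsto_drift hfc hf hκ hc₂0 hc₁ hc₂)
  have eB : B = (Dval ρ f ψ κ c₁ c₂)⁻¹ :=
    tendsto_nhds_unique hB ((tendsto_Dval hfc hf hκ hc₂0 hc₁ hc₂).inv₀ hD0.ne')
  rw [eA, eB] at l1 l2 l3
  rw [← V1_eq hs0] at l1
  rw [← V2_eq hs0] at l2
  rw [← V3_eq hμ hc hs0 hD0] at l3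
  refine ⟨hc₂0, hs0.lt_of_ne fun h0 => ?_, solvesSystem_of_eq_zero l1.symm l2.symm l3.symm⟩
  subst h0
  exact hsep.not_ge
    (le_psiSep_of_threshold_zero hfc hf hμ hc hm hκ hψ hc₂0 l1.symm l2.symm)

end System

/-- **(Stability of the nonlinear system: approximate solutions are close to the solution).** -/
theorem approximate_solution_close_to_solution
    (ρ : ℝ) (hρ : 0 < ρ)
    (f : ℝ → ℝ) (hf_cont : Continuous f) (hf_mono : Monotone f)
    (hf_range : ∀ t, f t ∈ Set.Icc (0 : ℝ) 1)
    (μ : Measure (ℝ × ℝ)) (hμ_prob : IsProbabilityMeasure μ)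
    (c C' C'' : ℝ) (hc0 : 0 < c) (hc1 : c < 1) (hC' : 0 < C') (hC'' : 0 < C'')
    (hμ_supp : μ {q : ℝ × ℝ | q.1 ∈ Set.Icc c c⁻¹ ∧ q.2 ∈ Set.Icc (-C') C'} = 1)
    (hμ_mom2 : ∫ q, q.2 ^ 2 ∂μ = 1) (hμ_mom1 : C'' ≤ ∫ q, |q.2| ∂μ)
    (κ ψ : ℝ) (hκ : 0 ≤ κ) (hψ : psiDown ρ f μ κ < ψ)
    -- the unique solution of the nonlinear system
    (c₁s c₂s ss : ℝ) (hc₂s : 0 < c₂s) (hss : 0 < ss)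
    (hsol : SolvesSystem ρ f ψ κ μ c₁s c₂s ss)
    (huniq : ∀ c₁ c₂ s : ℝ, 0 < c₂ → 0 < s → SolvesSystem ρ f ψ κ μ c₁ c₂ s →
      (c₁, c₂, s) = (c₁s, c₂s, ss)) :
    ∀ ε > (0 : ℝ), ∃ δ > (0 : ℝ), ∀ c₁ c₂ s : ℝ, 0 < c₂ → 0 < s →
      |V1 ρ f ψ κ μ c₁ c₂ s| ≤ δ * max c₂ 1 →
      |V2 ρ f ψ κ μ c₁ c₂ s| ≤ δ * (max c₂ 1) ^ 2 →
      |V3 ρ f ψ κ μ c₁ c₂ s| ≤ δ * max c₂ 1 →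
      Real.sqrt ((c₁ - c₁s) ^ 2 + (c₂ - c₂s) ^ 2 + (s - ss) ^ 2) ≤ ε := by
  have hsep : psiSep ρ f < ψ := (le_max_left _ _).trans_lt hψ
  have hψ0 : 0 < ψ := (Real.iInf_nonneg fun _ => sq_nonneg _).trans_lt hsep
  have hμ := supportedIn_of_measure_eq_one hμ_supp
  obtain ⟨δ₀, hδ₀, R, hR⟩ :=
    exists_bound_of_approx (ρ := ρ) hf_cont hf_range hμ hc0 hC'.le hκ hψ0
  by_contra! ⟨ε, hε, hcon⟩
  have hδn : ∀ n : ℕ, 0 < δ₀ * (1 / ((n : ℝ) + 1)) := fun n => by positivity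
  have hδle : ∀ n : ℕ, δ₀ * (1 / ((n : ℝ) + 1)) ≤ δ₀ := fun n =>
    mul_le_of_le_one_right hδ₀.le
      (div_le_one_of_le₀ (by linarith [n.cast_nonneg (α := ℝ)]) (by positivity))
  choose u₁ u₂ v hu₂ hv h1 h2 h3 hfar using fun n => hcon _ (hδn n)
  have hbd n := hR (u₁ n) (u₂ n) (v n) (hu₂ n) (hv n)
    ((h1 n).trans (by gcongr; exact hδle n))
    ((h2 n).trans (by gcongr; exact hδle n))
    ((h3 n).trans (by gcongr; exact hδle n))
  have hmax n : max (u₂ n) 1 ≤ max R 1 :=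
    max_le_max_right _ ((le_abs_self _).trans (hbd n).2.1)
  have hδlim : Tendsto (fun n : ℕ => δ₀ * (1 / ((n : ℝ) + 1))) atTop (𝓝 0) := by
    simpa using tendsto_one_div_add_atTop_nhds_zero_nat.const_mul δ₀
  have t1 : Tendsto (fun n => V1 ρ f ψ κ μ (u₁ n) (u₂ n) (v n)) atTop (𝓝 0) :=
    squeeze_zero_norm (fun n => (h1 n).trans (mul_le_mul_of_nonneg_left (hmax n) (hδn n).le))
      (by simpa using hδlim.mul_const (max R 1))
  have t2 : Tendsto (fun n => V2 ρ f ψ κ μ (u₁ n) (u₂ n) (v n)) atTop (𝓝 0) :=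
    squeeze_zero_norm (fun n => (h2 n).trans (mul_le_mul_of_nonneg_left
      (pow_le_pow_left₀ (by positivity) (hmax n) 2) (hδn n).le))
      (by simpa using hδlim.mul_const (max R 1 ^ 2))
  have t3 : Tendsto (fun n => V3 ρ f ψ κ μ (u₁ n) (u₂ n) (v n)) atTop (𝓝 0) :=
    squeeze_zero_norm (fun n => (h3 n).trans (mul_le_mul_of_nonneg_left (hmax n) (hδn n).le))
      (by simpa using hδlim.mul_const (max R 1))
  obtain ⟨⟨c₁, c₂, s, A, B⟩, -, φ, hφ, hlim⟩ := tendsto_subseq_of_bounded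
    (x := fun n => (u₁ n, u₂ n, v n, drift ρ f ψ κ (u₁ n) (u₂ n), (Dval ρ f ψ κ (u₁ n) (u₂ n))⁻¹))
    (Metric.isBounded_closedBall (x := 0) (r := R)) (fun n => by
      obtain ⟨b1, b2, b3, b4, b5⟩ := hbd n
      simp only [mem_closedBall_zero_iff, Prod.norm_mk, Real.norm_eq_abs, max_le_iff]
      exact ⟨b1, b2, b3, b4, b5⟩)
  simp only [Prod.tendsto_iff] at hlim
  obtain ⟨l1, l2, l3, lA, lB⟩ := hlim
  have hφ' := hφ.tendsto_atTop
  obtain ⟨hc₂, hs, hsys⟩ := solvesSystem_of_tendsto hf_cont hf_range hμ hc0 hμ_mom2 hκ hψ0 hsep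
    (fun n => hu₂ (φ n)) (fun n => hv (φ n)) l1 l2 l3 lA lB (t1.comp hφ') (t2.comp hφ')
    (t3.comp hφ')
  obtain ⟨rfl, rfl, rfl⟩ := by simpa using huniq c₁ c₂ s hc₂ hs hsys
  have hdist : Tendsto (fun n => √((u₁ (φ n) - c₁) ^ 2 + (u₂ (φ n) - c₂) ^ 2 + (v (φ n) - s) ^ 2))
      atTop (𝓝 0) := by
    have h := ((((l1.sub_const c₁).pow 2).add ((l2.sub_const c₂).pow 2)).add
      ((l3.sub_const s).pow 2)).sqrt
    simpa using h
  exact hε.not_ge (ge_of_tendsto' hdist fun n => (hfar (φ n)).le)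
end
end

section
/- Let q ≥ 1, let X ∈ ℝ^{n×p} satisfy |X_{ij}| ≤ M for all i,j, let y ∈ {−1,+1}^n, and suppose κ_{n,ℓq} > 0. Fix 0 < ε < 1 and run the boosting iteration with shrinkage factor β = ε/(p^{2/q⋆}·M²). Then for every integer T with T ≥ log(1.01·n·e) · 2·p^{2/q⋆}·M²·ε^{−2} / κ_{n,ℓq}², the iterate θ_T satisfies θ_T ≠ 0 and κ_{n,ℓq} ≥ min_{1≤i≤n} y_i·x_iᵀθ_T / ‖θ_T‖_q > κ_{n,ℓq}·(1 − ε). -/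
open Filter

noncomputable section

/-- The ℓq norm `(∑ |u j|^q)^{1/q}` on `Fin p → ℝ`. -/
def lqNorm (q : ℝ) {p : ℕ} (u : Fin p → ℝ) : ℝ := (∑ j, |u j| ^ q) ^ (1 / q)

/-- The ℓq⋆ norm for the conjugate exponent `1/q + 1/q⋆ = 1`, with the convention `q⋆ = ∞`
(sup norm) when `q = 1`. -/
def lqDualNorm (q : ℝ) {p : ℕ} (u : Fin p → ℝ) : ℝ :=
  if q = 1 then ⨆ j, |u j| else (∑ j, |u j| ^ (q / (q - 1))) ^ ((q - 1) / q)

/-- `p^{2/q⋆}`, with the convention `p^{2/q⋆} = 1` when `q = 1`. -/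
def pPow (q : ℝ) (p : ℕ) : ℝ := if q = 1 then 1 else (p : ℝ) ^ (2 * (q - 1) / q)

/-- The max-ℓq-margin `κ_{n,ℓq}` of the data. -/
def maxMarginQ (q : ℝ) {n p : ℕ} (X : Fin n → Fin p → ℝ) (y : Fin n → ℝ) : ℝ :=
  sSup {m : ℝ | ∃ θ : Fin p → ℝ, lqNorm q θ ≤ 1 ∧ m = ⨅ i, y i * ∑ j, X i j * θ j}

lemma lqNorm_nonneg (q : ℝ) {p : ℕ} (u : Fin p → ℝ) : 0 ≤ lqNorm q u :=
  Real.rpow_nonneg (Finset.sum_nonneg fun _ _ => Real.rpow_nonneg (abs_nonneg _) _) _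

lemma lqNorm_zero {q : ℝ} (hq : 1 ≤ q) {p : ℕ} : lqNorm q (0 : Fin p → ℝ) = 0 := by
  have hq0 : q ≠ 0 := by positivity
  simp [lqNorm, Real.zero_rpow hq0, hq0]

lemma lqNorm_pos_of_ne_zero (q : ℝ) {p : ℕ} {u : Fin p → ℝ} (hu : u ≠ 0) : 0 < lqNorm q u := by
  obtain ⟨j, hj⟩ := Function.ne_iff.mp hu
  refine Real.rpow_pos_of_pos (Finset.sum_pos' (fun _ _ => Real.rpow_nonneg (abs_nonneg _) _)
    ⟨j, Finset.mem_univ j, Real.rpow_pos_of_pos (abs_pos.mpr hj) _⟩) _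

lemma lqNorm_mul {q : ℝ} (hq : 1 ≤ q) {p : ℕ} (c : ℝ) (u : Fin p → ℝ) :
    lqNorm q (fun j => c * u j) = |c| * lqNorm q u := by
  have hq0 : q ≠ 0 := by positivity
  simp only [lqNorm, abs_mul, Real.mul_rpow (abs_nonneg _) (abs_nonneg _), ← Finset.mul_sum]
  rw [Real.mul_rpow (Real.rpow_nonneg (abs_nonneg _) _)
    (Finset.sum_nonneg fun _ _ => Real.rpow_nonneg (abs_nonneg _) _),
    ← Real.rpow_mul (abs_nonneg _), mul_one_div_cancel hq0, Real.rpow_one]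

lemma lqNorm_add_le {q : ℝ} (hq : 1 ≤ q) {p : ℕ} (u w : Fin p → ℝ) :
    lqNorm q (fun j => u j + w j) ≤ lqNorm q u + lqNorm q w :=
  Real.Lp_add_le Finset.univ u w hq

lemma lqDualNorm_nonneg (q : ℝ) {p : ℕ} (u : Fin p → ℝ) : 0 ≤ lqDualNorm q u := by
  unfold lqDualNorm
  split_ifs
  · exact Real.iSup_nonneg fun _ => abs_nonneg _
  · exact Real.rpow_nonneg (Finset.sum_nonneg fun _ _ => Real.rpow_nonneg (abs_nonneg _) _) _

/-- Hölder's inequality for the pair of norms `lqDualNorm q`, `lqNorm q`. -/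
lemma sum_mul_le_lqDualNorm_mul_lqNorm {q : ℝ} (hq : 1 ≤ q) {p : ℕ} (a u : Fin p → ℝ) :
    ∑ j, a j * u j ≤ lqDualNorm q a * lqNorm q u := by
  unfold lqDualNorm
  split_ifs with h
  · subst h
    simp only [lqNorm, Real.rpow_one, div_one, Finset.mul_sum]
    refine Finset.sum_le_sum fun j _ => (le_abs_self _).trans ?_
    rw [abs_mul]
    gcongr
    exact le_ciSup (f := fun j => |a j|) (Set.finite_range _).bddAbove j
  · have hq1 : 1 < q := lt_of_le_of_ne hq (Ne.symm h)
    have := Real.inner_le_Lp_mul_Lq Finset.univ a u (Real.HolderConjugate.conjExponent hq1).symm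
    simpa only [Real.conjExponent, one_div_div, lqNorm] using this

lemma abs_sum_mul_le_lqDualNorm_mul_lqNorm {q : ℝ} (hq : 1 ≤ q) {p : ℕ} (a u : Fin p → ℝ) :
    |∑ j, a j * u j| ≤ lqDualNorm q a * lqNorm q u := by
  refine abs_le'.mpr ⟨sum_mul_le_lqDualNorm_mul_lqNorm hq a u, ?_⟩
  have := sum_mul_le_lqDualNorm_mul_lqNorm hq a (fun j => (-1) * u j)
  rw [lqNorm_mul hq] at this
  simpa using this

lemma pPow_pos (q : ℝ) {p : ℕ} (hp : 0 < p) : 0 < pPow q p := by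
  unfold pPow
  split_ifs <;> positivity

lemma lqDualNorm_sq_le {q : ℝ} (hq : 1 ≤ q) {p : ℕ} {M : ℝ} (hM : 0 ≤ M) {u : Fin p → ℝ}
    (hu : ∀ j, |u j| ≤ M) : lqDualNorm q u ^ 2 ≤ pPow q p * M ^ 2 := by
  have hnonneg := lqDualNorm_nonneg q u
  unfold lqDualNorm pPow at *
  split_ifs at * with h
  · rw [one_mul]
    gcongr
    exact Real.iSup_le hu hM
  · have hq1 : 0 < q - 1 := sub_pos.mpr (lt_of_le_of_ne hq (Ne.symm h))
    have hq0 : 0 < q := by positivity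
    have hsum : ∑ j, |u j| ^ (q / (q - 1)) ≤ (p : ℝ) * M ^ (q / (q - 1)) := by
      refine (Finset.sum_le_card_nsmul Finset.univ _ (M ^ (q / (q - 1))) fun j _ => ?_).trans_eq
        (by simp)
      exact Real.rpow_le_rpow (abs_nonneg _) (hu j) (by positivity)
    have hle : (∑ j, |u j| ^ (q / (q - 1))) ^ ((q - 1) / q) ≤ (p : ℝ) ^ ((q - 1) / q) * M := by
      refine (Real.rpow_le_rpow (Finset.sum_nonneg fun _ _ => Real.rpow_nonneg (abs_nonneg _) _)
        hsum (by positivity)).trans_eq ?_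
      rw [Real.mul_rpow (by positivity) (by positivity), ← Real.rpow_mul hM,
        div_mul_div_cancel₀ hq1.ne', div_self hq0.ne', Real.rpow_one]
    refine (pow_le_pow_left₀ hnonneg hle 2).trans_eq ?_
    rw [mul_pow, ← Real.rpow_mul_natCast (by positivity)]
    congr 2
    push_cast
    ring

/-- Hoeffding's lemma for a finitely supported distribution. -/
lemma sum_mul_exp_neg_le {n : ℕ} {w z : Fin n → ℝ} (hw : ∀ i, 0 ≤ w i) (hw1 : ∑ i, w i = 1)
    {C : ℝ} (hz : ∀ i, z i ^ 2 ≤ C) (a : ℝ) :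
    ∑ i, w i * Real.exp (-a * z i) ≤ Real.exp (-a * ∑ i, w i * z i + a ^ 2 * C / 2) := by
  have hC : 0 ≤ C := by
    obtain ⟨i⟩ : Nonempty (Fin n) := by
      by_contra h
      rw [not_nonempty_iff] at h
      simp at hw1
    exact (sq_nonneg _).trans (hz i)
  let P : PMF (Fin n) := PMF.ofFintype (fun i => ENNReal.ofReal (w i)) (by
    rw [← ENNReal.ofReal_sum_of_nonneg fun i _ => hw i, hw1, ENNReal.ofReal_one])
  have hint (f : Fin n → ℝ) : ∫ i, f i ∂P.toMeasure = ∑ i, w i * f i := by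
    rw [PMF.integral_eq_sum]
    simp [P, ENNReal.toReal_ofReal (hw _)]
  have hsub := ProbabilityTheory.hasSubgaussianMGF_of_mem_Icc (μ := P.toMeasure) (X := z)
    (a := -√C) (b := √C) (measurable_of_finite z).aemeasurable
    (Filter.Eventually.of_forall fun i => abs_le.mp (Real.abs_le_sqrt (hz i)))
  have hmgf := hsub.mgf_le (-a)
  have hvar : (((‖√C - -√C‖₊ / 2) ^ 2 : NNReal) : ℝ) = C := by
    push_cast
    rw [Real.norm_of_nonneg (by have := Real.sqrt_nonneg C; linarith), sub_neg_eq_add,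
      add_self_div_two, Real.sq_sqrt hC]
  rw [ProbabilityTheory.mgf, hint, hint, hvar] at hmgf
  calc ∑ i, w i * Real.exp (-a * z i)
      = Real.exp (-a * ∑ i, w i * z i) *
          ∑ i, w i * Real.exp (-a * (z i - ∑ k, w k * z k)) := by
        rw [Finset.mul_sum]
        refine Finset.sum_congr rfl fun i _ => ?_
        rw [mul_left_comm, ← Real.exp_add]
        congr 2
        ring
    _ ≤ Real.exp (-a * ∑ i, w i * z i) * Real.exp (C * (-a) ^ 2 / 2) := by gcongr
    _ = Real.exp (-a * ∑ i, w i * z i + a ^ 2 * C / 2) := by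
        rw [← Real.exp_add]
        congr 1
        ring

lemma bddAbove_of_maxMarginQ_pos {q : ℝ} {n p : ℕ} {X : Fin n → Fin p → ℝ} {y : Fin n → ℝ}
    (hκ : 0 < maxMarginQ q X y) :
    BddAbove {m : ℝ | ∃ θ : Fin p → ℝ, lqNorm q θ ≤ 1 ∧ m = ⨅ i, y i * ∑ j, X i j * θ j} := by
  by_contra h
  exact hκ.ne' (Real.sSup_of_not_bddAbove h)

lemma margin_div_lqNorm_le_maxMarginQ {q : ℝ} (hq : 1 ≤ q) {n p : ℕ} {X : Fin n → Fin p → ℝ}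
    {y : Fin n → ℝ} (hκ : 0 < maxMarginQ q X y) {θ : Fin p → ℝ} (hθ : θ ≠ 0) :
    (⨅ i, y i * ∑ j, X i j * θ j) / lqNorm q θ ≤ maxMarginQ q X y := by
  have hpos := lqNorm_pos_of_ne_zero q hθ
  refine le_csSup (bddAbove_of_maxMarginQ_pos hκ) ⟨fun j => (lqNorm q θ)⁻¹ * θ j, ?_, ?_⟩
  · rw [lqNorm_mul hq, abs_of_pos (inv_pos.mpr hpos), inv_mul_cancel₀ hpos.ne']
  · rw [div_eq_inv_mul, Real.mul_iInf_of_nonneg (inv_nonneg.mpr hpos.le)]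
    congr! 2 with i
    simp only [Finset.mul_sum]
    exact Finset.sum_congr rfl fun j _ => by ring

lemma sum_weights_mul_margin {n p : ℕ} {X Z : Fin n → Fin p → ℝ} {y : Fin n → ℝ}
    (hZ : ∀ i j, Z i j = y i * X i j) (w : Fin n → ℝ) (u : Fin p → ℝ) :
    ∑ i, w i * (y i * ∑ j, X i j * u j) = ∑ j, (∑ i, w i * Z i j) * u j := by
  simp only [Finset.mul_sum, Finset.sum_mul, hZ]
  rw [Finset.sum_comm]
  exact Finset.sum_congr rfl fun _ _ => Finset.sum_congr rfl fun _ _ => by ring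

/-- Weak duality: the dual norm of any convex combination of the examples is at least the
maximal margin. -/
lemma maxMarginQ_le_lqDualNorm {q : ℝ} (hq : 1 ≤ q) {n p : ℕ} {X Z : Fin n → Fin p → ℝ}
    {y : Fin n → ℝ} (hZ : ∀ i j, Z i j = y i * X i j) {w : Fin n → ℝ} (hw : ∀ i, 0 ≤ w i)
    (hw1 : ∑ i, w i = 1) : maxMarginQ q X y ≤ lqDualNorm q (fun j => ∑ i, w i * Z i j) := by
  refine Real.sSup_le ?_ (lqDualNorm_nonneg _ _)
  rintro m ⟨u, hu, rfl⟩
  calc ⨅ i, y i * ∑ j, X i j * u j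
      = ∑ i, w i * ⨅ i, y i * ∑ j, X i j * u j := by rw [← Finset.sum_mul, hw1, one_mul]
    _ ≤ ∑ i, w i * (y i * ∑ j, X i j * u j) := Finset.sum_le_sum fun i _ =>
        mul_le_mul_of_nonneg_left (ciInf_le (Set.finite_range _).bddBelow i) (hw i)
    _ = ∑ j, (∑ i, w i * Z i j) * u j := sum_weights_mul_margin hZ w u
    _ ≤ lqDualNorm q (fun j => ∑ i, w i * Z i j) * lqNorm q u :=
        sum_mul_le_lqDualNorm_mul_lqNorm hq _ u
    _ ≤ lqDualNorm q (fun j => ∑ i, w i * Z i j) :=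
        mul_le_of_le_one_right (lqDualNorm_nonneg _ _) hu

/-- **Corollary 2.2 (boosting converges to the max-ℓq-margin direction).** -/
theorem boosting_converges_to_max_lq_margin
    (q : ℝ) (hq : 1 ≤ q) (n p : ℕ) (hn : 0 < n) (hp : 0 < p)
    (M : ℝ) (hM : 0 < M)
    (X : Fin n → Fin p → ℝ) (hX : ∀ i j, |X i j| ≤ M)
    (y : Fin n → ℝ) (hy : ∀ i, y i = 1 ∨ y i = -1)
    (Z : Fin n → Fin p → ℝ) (hZ : ∀ i j, Z i j = y i * X i j)
    (hκ : 0 < maxMarginQ q X y)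
    (ε : ℝ) (hε0 : 0 < ε) (hε1 : ε < 1)
    (β : ℝ) (hβ : β = ε / (pPow q p * M ^ 2))
    -- the boosting iteration with shrinkage factor β
    (θ : ℕ → Fin p → ℝ) (η : ℕ → Fin n → ℝ) (v : ℕ → Fin p → ℝ) (α : ℕ → ℝ)
    (hθ0 : θ 0 = 0) (hη0 : ∀ i, η 0 i = 1 / n)
    (hv_norm : ∀ t : ℕ, lqNorm q (v (t + 1)) = 1)
    (hv_max : ∀ t : ℕ, (∑ j, (∑ i, η t i * Z i j) * v (t + 1) j) =
      lqDualNorm q (fun j => ∑ i, η t i * Z i j))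
    (hα : ∀ t : ℕ, α t = β * lqDualNorm q (fun j => ∑ i, η t i * Z i j))
    (hθ_step : ∀ (t : ℕ) (j : Fin p), θ (t + 1) j = θ t j + α t * v (t + 1) j)
    (hη_step : ∀ (t : ℕ) (i : Fin n), η (t + 1) i =
      η t i * Real.exp (-(α t) * (y i * ∑ j, X i j * v (t + 1) j)) /
        ∑ i', η t i' * Real.exp (-(α t) * (y i' * ∑ j, X i' j * v (t + 1) j)))
    (T : ℕ)
    (hT : Real.log (1.01 * n * Real.exp 1) * (2 * pPow q p * M ^ 2 / ε ^ 2) /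
        maxMarginQ q X y ^ 2 ≤ (T : ℝ)) :
    θ T ≠ 0 ∧
    (⨅ i, y i * ∑ j, X i j * θ T j) / lqNorm q (θ T) ≤ maxMarginQ q X y ∧
    maxMarginQ q X y * (1 - ε) < (⨅ i, y i * ∑ j, X i j * θ T j) / lqNorm q (θ T) := by
  have : Nonempty (Fin n) := ⟨⟨0, hn⟩⟩
  have hn' : (0 : ℝ) < n := Nat.cast_pos.mpr hn
  have hC : 0 < pPow q p * M ^ 2 := mul_pos (pPow_pos q hp) (by positivity)
  set C := pPow q p * M ^ 2 with hCdef
  set κ := maxMarginQ q X y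
  set g : ℕ → ℝ := fun t => lqDualNorm q (fun j => ∑ i, η t i * Z i j)
  have hβ0 : 0 < β := hβ ▸ div_pos hε0 hC
  have hη : ∀ t, (∀ i, 0 < η t i) ∧ ∑ i, η t i = 1 := by
    intro t
    induction t with
    | zero =>
      refine ⟨fun i => by rw [hη0]; positivity, ?_⟩
      simp [hη0, hn'.ne']
    | succ t ih =>
      have hpos : 0 < ∑ i', η t i' * Real.exp (-(α t) * (y i' * ∑ j, X i' j * v (t + 1) j)) :=
        Finset.sum_pos (fun i _ => mul_pos (ih.1 i) (Real.exp_pos _)) Finset.univ_nonempty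
      refine ⟨fun i => ?_, ?_⟩
      · rw [hη_step]
        exact div_pos (mul_pos (ih.1 i) (Real.exp_pos _)) hpos
      · simp only [hη_step]
        rw [← Finset.sum_div, div_self hpos.ne']
  have hgκ (t : ℕ) : κ ≤ g t := maxMarginQ_le_lqDualNorm hq hZ (fun i => ((hη t).1 i).le) (hη t).2
  have hmargin (t : ℕ) (i : Fin n) : (y i * ∑ j, X i j * v (t + 1) j) ^ 2 ≤ C := by
    have hy2 : y i ^ 2 = 1 := by rcases hy i with h | h <;> simp [h]
    have h := abs_sum_mul_le_lqDualNorm_mul_lqNorm hq (X i) (v (t + 1))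
    rw [hv_norm, mul_one] at h
    rw [mul_pow, hy2, one_mul, ← sq_abs]
    exact (pow_le_pow_left₀ (abs_nonneg _) h 2).trans (lqDualNorm_sq_le hq hM.le (hX i))
  have hstep (t : ℕ) : ∑ i, η t i * Real.exp (-(α t) * (y i * ∑ j, X i j * v (t + 1) j)) ≤
      Real.exp (-(β * (1 - ε / 2) * g t ^ 2)) := by
    refine (sum_mul_exp_neg_le (fun i => ((hη t).1 i).le) (hη t).2 (hmargin t) (α t)).trans_eq ?_
    rw [sum_weights_mul_margin hZ, hv_max, hα]
    change Real.exp (-(β * g t) * g t + (β * g t) ^ 2 * C / 2) = _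
    have hβC : β * C = ε := by rw [hβ, div_mul_cancel₀ _ hC.ne']
    congr 1
    linear_combination (β * g t ^ 2 / 2) * hβC
  have hpotential (t : ℕ) (i : Fin n) : Real.exp (-(y i * ∑ j, X i j * θ t j)) ≤
      n * η t i * Real.exp (-(β * (1 - ε / 2) * ∑ s ∈ Finset.range t, g s ^ 2)) := by
    induction t with
    | zero => simp [hθ0, hη0, hn'.ne']
    | succ t ih =>
      have hpos : 0 < ∑ i', η t i' * Real.exp (-(α t) * (y i' * ∑ j, X i' j * v (t + 1) j)) :=
        Finset.sum_pos (fun i _ => mul_pos ((hη t).1 i) (Real.exp_pos _)) Finset.univ_nonempty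
      have hlin : -(y i * ∑ j, X i j * θ (t + 1) j) =
          -(y i * ∑ j, X i j * θ t j) + -(α t) * (y i * ∑ j, X i j * v (t + 1) j) := by
        simp only [hθ_step, mul_add, Finset.sum_add_distrib, mul_left_comm _ (α t),
          ← Finset.mul_sum]
        ring
      have hηs := (eq_div_iff hpos.ne').mp (hη_step t i)
      calc Real.exp (-(y i * ∑ j, X i j * θ (t + 1) j))
          = Real.exp (-(y i * ∑ j, X i j * θ t j)) *
              Real.exp (-(α t) * (y i * ∑ j, X i j * v (t + 1) j)) := by
            rw [hlin, Real.exp_add]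
        _ ≤ n * η t i * Real.exp (-(β * (1 - ε / 2) * ∑ s ∈ Finset.range t, g s ^ 2)) *
              Real.exp (-(α t) * (y i * ∑ j, X i j * v (t + 1) j)) := by gcongr
        _ = n * Real.exp (-(β * (1 - ε / 2) * ∑ s ∈ Finset.range t, g s ^ 2)) *
              (η t i * Real.exp (-(α t) * (y i * ∑ j, X i j * v (t + 1) j))) := by ring
        _ = n * Real.exp (-(β * (1 - ε / 2) * ∑ s ∈ Finset.range t, g s ^ 2)) *
              (η (t + 1) i *
                ∑ i', η t i' * Real.exp (-(α t) * (y i' * ∑ j, X i' j * v (t + 1) j))) := by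
            rw [hηs]
        _ ≤ n * Real.exp (-(β * (1 - ε / 2) * ∑ s ∈ Finset.range t, g s ^ 2)) *
              (η (t + 1) i * Real.exp (-(β * (1 - ε / 2) * g t ^ 2))) := by
            have := ((hη (t + 1)).1 i).le
            gcongr
            exact hstep t
        _ = n * η (t + 1) i *
              Real.exp (-(β * (1 - ε / 2) * ∑ s ∈ Finset.range (t + 1), g s ^ 2)) := by
            rw [Finset.sum_range_succ, mul_add, neg_add, Real.exp_add]
            ring
  have hnorm (t : ℕ) : lqNorm q (θ t) ≤ β * ∑ s ∈ Finset.range t, g s := by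
    induction t with
    | zero => simp [hθ0, lqNorm_zero hq]
    | succ t ih =>
      have hαt : 0 ≤ α t := by
        rw [hα]
        exact mul_nonneg hβ0.le (lqDualNorm_nonneg _ _)
      have h := lqNorm_add_le hq (θ t) (fun j => α t * v (t + 1) j)
      rw [lqNorm_mul hq, hv_norm, mul_one, abs_of_nonneg hαt, ← funext (hθ_step t), hα] at h
      rw [Finset.sum_range_succ, mul_add]
      exact h.trans (by gcongr)
  set S := ∑ s ∈ Finset.range T, g s with hS
  have hS2 : κ * S ≤ ∑ s ∈ Finset.range T, g s ^ 2 := by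
    rw [hS, Finset.mul_sum]
    refine Finset.sum_le_sum fun s _ => ?_
    rw [sq]
    exact mul_le_mul_of_nonneg_right (hgκ s) (hκ.le.trans (hgκ s))
  have hST : T * κ ≤ S := by
    simpa using Finset.card_nsmul_le_sum (Finset.range T) g κ fun s _ => hgκ s
  have hlog : Real.log n < Real.log (1.01 * n * Real.exp 1) := by
    have he : 1 < Real.exp 1 := Real.one_lt_exp_iff.mpr one_pos
    exact Real.log_lt_log hn' (by nlinarith)
  have hlogS : Real.log n < β * (ε / 2) * (κ * S) := by
    rw [div_le_iff₀ (by positivity)] at hT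
    have h1 : Real.log (1.01 * n * Real.exp 1) ≤ β * (ε / 2) * (T * κ ^ 2) := by
      have h2 : (2 * pPow q p * M ^ 2 / ε ^ 2) * (β * (ε / 2)) = 1 := by
        rw [hβ, mul_assoc 2, ← hCdef]
        field_simp
      calc Real.log (1.01 * n * Real.exp 1)
          = Real.log (1.01 * n * Real.exp 1) * (2 * pPow q p * M ^ 2 / ε ^ 2) *
              (β * (ε / 2)) := by
            linear_combination -Real.log (1.01 * n * Real.exp 1) * h2
        _ ≤ T * κ ^ 2 * (β * (ε / 2)) := by gcongr
        _ = β * (ε / 2) * (T * κ ^ 2) := by ring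
    calc Real.log n < β * (ε / 2) * (T * κ ^ 2) := hlog.trans_le h1
      _ = β * (ε / 2) * (κ * (T * κ)) := by ring
      _ ≤ β * (ε / 2) * (κ * S) := by gcongr
  have hmin : β * (1 - ε / 2) * (κ * S) - Real.log n ≤ ⨅ i, y i * ∑ j, X i j * θ T j := by
    refine le_ciInf fun i => ?_
    have hη1 : η T i ≤ 1 := (hη T).2 ▸
      Finset.single_le_sum (fun k _ => ((hη T).1 k).le) (Finset.mem_univ i)
    have h : Real.exp (-(y i * ∑ j, X i j * θ T j)) ≤
        Real.exp (Real.log n + -(β * (1 - ε / 2) * ∑ s ∈ Finset.range T, g s ^ 2)) := by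
      rw [Real.exp_add, Real.exp_log hn']
      refine (hpotential T i).trans ?_
      gcongr
      exact mul_le_of_le_one_right hn'.le hη1
    have h2 : β * (1 - ε / 2) * (κ * S) ≤ β * (1 - ε / 2) * ∑ s ∈ Finset.range T, g s ^ 2 :=
      mul_le_mul_of_nonneg_left hS2 (mul_nonneg hβ0.le (by linarith))
    linarith [Real.exp_le_exp.mp h]
  have hlt : κ * (1 - ε) * (β * S) < ⨅ i, y i * ∑ j, X i j * θ T j := by
    linear_combination hmin + hlogS
  have hfac : 0 < κ * (1 - ε) := mul_pos hκ (by linarith)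
  have hbound : κ * (1 - ε) * lqNorm q (θ T) < ⨅ i, y i * ∑ j, X i j * θ T j :=
    (mul_le_mul_of_nonneg_left (hnorm T) hfac.le).trans_lt hlt
  have hθ : θ T ≠ 0 := by
    intro h
    simp [h, lqNorm_zero hq] at hbound
  exact ⟨hθ, margin_div_lqNorm_le_maxMarginQ hq hκ hθ,
    (lt_div_iff₀ (lqNorm_pos_of_ne_zero q hθ)).mpr hbound⟩
end
end

section
/- Let X ∈ ℝ^{n×p} satisfy |X_{ij}| ≤ M for all i,j, let y ∈ {−1,+1}^n, and suppose κ_{n,ℓ₁} > 0. Run the boosting iteration with q = 1 and shrinkage factor β = 1/M². Then for every ε > 0 and every integer T with T ≥ (2M²/κ_{n,ℓ₁}²)·log(n·e/ε), the iterate θ_T satisfies Σ_{i=1}^n 1{y_i·x_iᵀθ_T ≤ 0} ≤ ε. -/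
open Filter

noncomputable section

/-- On `[0, ∞)`, `cosh a - a sinh a ≤ exp (-a² / 2)`. -/
theorem cosh_sub_mul_sinh_le_exp {a : ℝ} (ha : 0 ≤ a) :
    Real.cosh a - a * Real.sinh a ≤ Real.exp (-(a ^ 2 / 2)) := by
  have hderiv : ∀ x : ℝ, HasDerivAt
      (fun x : ℝ => Real.exp (x ^ 2 / 2) * (Real.cosh x - x * Real.sinh x))
      (-(Real.exp (x ^ 2 / 2) * (x ^ 2 * Real.sinh x))) x := by
    intro x
    have h₁ : HasDerivAt (fun x : ℝ => Real.exp (x ^ 2 / 2)) (Real.exp (x ^ 2 / 2) * x) x := by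
      have h := (((hasDerivAt_id x).pow 2).div_const 2).exp
      simpa using h
    have h₂ := (Real.hasDerivAt_cosh x).sub ((hasDerivAt_id x).mul (Real.hasDerivAt_sinh x))
    refine (h₁.mul h₂).congr_deriv ?_
    simp only [id, Pi.sub_apply, Pi.mul_apply]
    ring
  have hanti : AntitoneOn
      (fun x : ℝ => Real.exp (x ^ 2 / 2) * (Real.cosh x - x * Real.sinh x)) (Set.Ici 0) := by
    refine antitoneOn_of_deriv_nonpos (convex_Ici 0)
      (fun x _ => (hderiv x).continuousAt.continuousWithinAt)
      (fun x _ => (hderiv x).differentiableAt.differentiableWithinAt) fun x hx => ?_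
    rw [interior_Ici, Set.mem_Ioi] at hx
    rw [(hderiv x).deriv, neg_nonpos]
    have := Real.sinh_nonneg_iff.2 hx.le
    positivity
  have h := hanti (Set.mem_Ici.2 le_rfl) (Set.mem_Ici.2 ha) ha
  simp only [Real.cosh_zero, zero_mul, sub_zero, mul_one] at h
  rw [Real.exp_neg, ← one_div, le_div_iff₀ (Real.exp_pos _), mul_comm]
  simpa using h

/-- The chord bound for the convex function `exp` on `[-a, a]`. -/
theorem exp_neg_mul_le_cosh_sub {a x : ℝ} (hx : |x| ≤ 1) :
    Real.exp (-(a * x)) ≤ Real.cosh a - x * Real.sinh a := by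
  obtain ⟨h₁, h₂⟩ := abs_le.1 hx
  have h := convexOn_exp.2 (Set.mem_univ (-a)) (Set.mem_univ a)
    (by linarith : 0 ≤ (1 + x) / 2) (by linarith : 0 ≤ (1 - x) / 2) (by ring)
  simp only [smul_eq_mul] at h
  rw [show (1 + x) / 2 * -a + (1 - x) / 2 * a = -(a * x) by ring] at h
  rw [Real.cosh_eq, Real.sinh_eq]
  linarith

/-- Exponential moment bound for a weighted average with values in `[-M, M]` and mean `γ ≥ 0`,
at the exponent `γ / M²`. -/
theorem sum_mul_exp_le_of_abs_le {ι : Type*} [Fintype ι] {w u : ι → ℝ} {M γ : ℝ}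
    (hM : 0 < M) (hw : ∀ i, 0 ≤ w i) (hw_sum : ∑ i, w i = 1) (hu : ∀ i, |u i| ≤ M)
    (hγ : ∑ i, w i * u i = γ) (hγ0 : 0 ≤ γ) :
    ∑ i, w i * Real.exp (-(γ / M ^ 2) * u i) ≤ Real.exp (-(γ ^ 2 / (2 * M ^ 2))) := by
  calc ∑ i, w i * Real.exp (-(γ / M ^ 2) * u i)
      ≤ ∑ i, w i * (Real.cosh (γ / M) - u i / M * Real.sinh (γ / M)) := by
        refine Finset.sum_le_sum fun i _ => mul_le_mul_of_nonneg_left ?_ (hw i)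
        have h : |u i / M| ≤ 1 := by
          rw [abs_div, abs_of_pos hM, div_le_one hM]
          exact hu i
        rw [show -(γ / M ^ 2) * u i = -(γ / M * (u i / M)) by ring]
        exact exp_neg_mul_le_cosh_sub h
    _ = (∑ i, w i) * Real.cosh (γ / M) - (∑ i, w i * u i) * (Real.sinh (γ / M) / M) := by
        rw [Finset.sum_mul, Finset.sum_mul, ← Finset.sum_sub_distrib]
        exact Finset.sum_congr rfl fun i _ => by ring
    _ = Real.cosh (γ / M) - γ / M * Real.sinh (γ / M) := by
        rw [hw_sum, hγ]
        ring
    _ ≤ Real.exp (-((γ / M) ^ 2 / 2)) := cosh_sub_mul_sinh_le_exp (by positivity)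
    _ = Real.exp (-(γ ^ 2 / (2 * M ^ 2))) := by
        rw [div_pow, div_div, mul_comm (M ^ 2)]

theorem lqNorm_one {p : ℕ} (u : Fin p → ℝ) : lqNorm 1 u = ∑ j, |u j| := by
  simp [lqNorm]

theorem abs_le_lqDualNorm_one {p : ℕ} (u : Fin p → ℝ) (j : Fin p) : |u j| ≤ lqDualNorm 1 u := by
  rw [lqDualNorm, if_pos rfl]
  exact le_ciSup (f := fun j => |u j|) (Set.finite_range _).bddAbove j

theorem lqDualNorm_one_nonneg {p : ℕ} (u : Fin p → ℝ) : 0 ≤ lqDualNorm 1 u := by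
  rw [lqDualNorm, if_pos rfl]
  exact Real.iSup_nonneg fun j => abs_nonneg _

theorem abs_sum_mul_le {ι : Type*} [Fintype ι] {a b : ι → ℝ} {C : ℝ} (ha : ∀ j, |a j| ≤ C) :
    |∑ j, a j * b j| ≤ C * ∑ j, |b j| := by
  refine (Finset.abs_sum_le_sum_abs _ _).trans ?_
  rw [Finset.mul_sum]
  refine Finset.sum_le_sum fun j _ => ?_
  rw [abs_mul]
  exact mul_le_mul_of_nonneg_right (ha j) (abs_nonneg _)

theorem sum_mul_margin_eq {n p : ℕ} {X Z : Fin n → Fin p → ℝ} {y : Fin n → ℝ}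
    (hZ : ∀ i j, Z i j = y i * X i j) (w : Fin n → ℝ) (θ : Fin p → ℝ) :
    ∑ i, w i * (y i * ∑ j, X i j * θ j) = ∑ j, (∑ i, w i * Z i j) * θ j := by
  simp only [Finset.mul_sum, Finset.sum_mul, hZ]
  rw [Finset.sum_comm]
  exact Finset.sum_congr rfl fun j _ => Finset.sum_congr rfl fun i _ => by ring

/-- Weak duality: the max-ℓ₁-margin is at most `‖Zᵀw‖_∞` for every `w` in the simplex. -/
theorem maxMarginQ_one_le_lqDualNorm {n p : ℕ} {X Z : Fin n → Fin p → ℝ} {y : Fin n → ℝ}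
    (hZ : ∀ i j, Z i j = y i * X i j) {w : Fin n → ℝ} (hw : ∀ i, 0 ≤ w i)
    (hw_sum : ∑ i, w i = 1) :
    maxMarginQ 1 X y ≤ lqDualNorm 1 (fun j => ∑ i, w i * Z i j) := by
  refine csSup_le ⟨_, 0, by simp [lqNorm_one], rfl⟩ ?_
  rintro m ⟨θ, hθ, rfl⟩
  rw [lqNorm_one] at hθ
  calc ⨅ i, y i * ∑ j, X i j * θ j
      = ∑ k, w k * ⨅ i, y i * ∑ j, X i j * θ j := by rw [← Finset.sum_mul, hw_sum, one_mul]
    _ ≤ ∑ k, w k * (y k * ∑ j, X k j * θ j) := Finset.sum_le_sum fun k _ =>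
        mul_le_mul_of_nonneg_left
          (ciInf_le (f := fun i => y i * ∑ j, X i j * θ j) (Set.finite_range _).bddBelow k) (hw k)
    _ = ∑ j, (∑ i, w i * Z i j) * θ j := sum_mul_margin_eq hZ w θ
    _ ≤ lqDualNorm 1 (fun j => ∑ i, w i * Z i j) * ∑ j, |θ j| :=
        (le_abs_self _).trans
          (abs_sum_mul_le (abs_le_lqDualNorm_one fun j => ∑ i, w i * Z i j))
    _ ≤ lqDualNorm 1 (fun j => ∑ i, w i * Z i j) :=
        mul_le_of_le_one_right (lqDualNorm_one_nonneg _) hθ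

/-- **Proposition 5.2 (AdaBoost training error bound).** -/
theorem boosting_training_error_bound
    (q : ℝ) (hq : q = 1) (n p : ℕ) (hn : 0 < n) (hp : 0 < p)
    (M : ℝ) (hM : 0 < M)
    (X : Fin n → Fin p → ℝ) (hX : ∀ i j, |X i j| ≤ M)
    (y : Fin n → ℝ) (hy : ∀ i, y i = 1 ∨ y i = -1)
    (Z : Fin n → Fin p → ℝ) (hZ : ∀ i j, Z i j = y i * X i j)
    (hκ : 0 < maxMarginQ q X y)
    (β : ℝ) (hβ : β = 1 / M ^ 2)
    -- the boosting iteration with shrinkage factor β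
    (θ : ℕ → Fin p → ℝ) (η : ℕ → Fin n → ℝ) (v : ℕ → Fin p → ℝ) (α : ℕ → ℝ)
    (hθ0 : θ 0 = 0) (hη0 : ∀ i, η 0 i = 1 / n)
    (hv_norm : ∀ t : ℕ, lqNorm q (v (t + 1)) = 1)
    (hv_max : ∀ t : ℕ, (∑ j, (∑ i, η t i * Z i j) * v (t + 1) j) =
      lqDualNorm q (fun j => ∑ i, η t i * Z i j))
    (hα : ∀ t : ℕ, α t = β * lqDualNorm q (fun j => ∑ i, η t i * Z i j))
    (hθ_step : ∀ (t : ℕ) (j : Fin p), θ (t + 1) j = θ t j + α t * v (t + 1) j)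
    (hη_step : ∀ (t : ℕ) (i : Fin n), η (t + 1) i =
      η t i * Real.exp (-(α t) * (y i * ∑ j, X i j * v (t + 1) j)) /
        ∑ i', η t i' * Real.exp (-(α t) * (y i' * ∑ j, X i' j * v (t + 1) j)))
    (ε : ℝ) (hε : 0 < ε) (T : ℕ)
    (hT : 2 * M ^ 2 / maxMarginQ q X y ^ 2 * Real.log (n * Real.exp 1 / ε) ≤ (T : ℝ)) :
    (∑ i, if y i * ∑ j, X i j * θ T j ≤ 0 then (1 : ℝ) else 0) ≤ ε := by
  subst hq
  have : Nonempty (Fin n) := ⟨⟨0, hn⟩⟩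
  have hn' : (0 : ℝ) < n := Nat.cast_pos.2 hn
  set κ := maxMarginQ 1 X y
  let m : (Fin p → ℝ) → Fin n → ℝ := fun u i => y i * ∑ j, X i j * u j
  let L : ℕ → ℝ := fun t => ∑ i, Real.exp (-(m (θ t) i))
  have hL_pos : ∀ t, 0 < L t := fun t =>
    Finset.sum_pos (fun i _ => Real.exp_pos _) Finset.univ_nonempty
  have hm_step : ∀ t i, m (θ (t + 1)) i = m (θ t) i + α t * m (v (t + 1)) i := by
    intro t i
    simp only [m, hθ_step, mul_add, Finset.sum_add_distrib, Finset.mul_sum]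
    congr 1
    exact Finset.sum_congr rfl fun j _ => by ring
  have hexp : ∀ t i, Real.exp (-(m (θ (t + 1)) i)) =
      Real.exp (-(m (θ t) i)) * Real.exp (-(α t) * m (v (t + 1)) i) := by
    intro t i
    rw [hm_step, ← Real.exp_add]
    ring_nf
  have hη : ∀ t i, η t i = Real.exp (-(m (θ t) i)) / L t := by
    intro t
    induction t with
    | zero => intro i; simp [hη0, L, m, hθ0]
    | succ t ih =>
      intro i
      have hsum : ∑ k, η t k * Real.exp (-(α t) * m (v (t + 1)) k) = L (t + 1) / L t := by
        simp only [L, Finset.sum_div]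
        exact Finset.sum_congr rfl fun k _ => by rw [ih, hexp]; simp only [L]; ring
      have h := hη_step t i
      change η (t + 1) i = η t i * Real.exp (-(α t) * m (v (t + 1)) i) /
        ∑ k, η t k * Real.exp (-(α t) * m (v (t + 1)) k) at h
      rw [h, hsum, ih, hexp]
      have := (hL_pos t).ne'
      have := (hL_pos (t + 1)).ne'
      field_simp
  have hη_nonneg : ∀ t i, 0 ≤ η t i := fun t i => by
    rw [hη]
    exact div_nonneg (Real.exp_pos _).le (hL_pos t).le
  have hη_sum : ∀ t, ∑ i, η t i = 1 := fun t => by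
    simp only [hη, ← Finset.sum_div]
    exact div_self (hL_pos t).ne'
  have hm_abs : ∀ t i, |m (v (t + 1)) i| ≤ M := fun t i => by
    have hy_abs : |y i| = 1 := by rcases hy i with h | h <;> simp [h]
    have h := abs_sum_mul_le (b := v (t + 1)) (hX i)
    rw [← lqNorm_one, hv_norm, mul_one] at h
    simpa [m, abs_mul, hy_abs] using h
  have hL_step : ∀ t, L (t + 1) ≤ L t * Real.exp (-(κ ^ 2 / (2 * M ^ 2))) := by
    intro t
    set γ := lqDualNorm 1 (fun j => ∑ i, η t i * Z i j) with hγ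
    have hκγ : κ ≤ γ := maxMarginQ_one_le_lqDualNorm hZ (hη_nonneg t) (hη_sum t)
    have hαγ : α t = γ / M ^ 2 := by rw [hα, hβ, ← hγ]; ring
    have hmean : ∑ i, η t i * m (v (t + 1)) i = γ :=
      (sum_mul_margin_eq hZ (η t) (v (t + 1))).trans (hv_max t)
    have hmoment := sum_mul_exp_le_of_abs_le hM (hη_nonneg t) (hη_sum t) (hm_abs t) hmean
      (hκ.le.trans hκγ)
    have hL_eq : L (t + 1) = L t * ∑ i, η t i * Real.exp (-(γ / M ^ 2) * m (v (t + 1)) i) := by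
      rw [Finset.mul_sum]
      refine Finset.sum_congr rfl fun i _ => ?_
      rw [hexp, hη, hαγ]
      have := (hL_pos t).ne'
      field_simp
    rw [hL_eq]
    refine mul_le_mul_of_nonneg_left (hmoment.trans ?_) (hL_pos t).le
    gcongr
  have hL_le : ∀ t : ℕ, L t ≤ n * Real.exp (-(κ ^ 2 / (2 * M ^ 2) * t)) := by
    intro t
    induction t with
    | zero => simp [L, m, hθ0]
    | succ t ih =>
      calc L (t + 1) ≤ L t * Real.exp (-(κ ^ 2 / (2 * M ^ 2))) := hL_step t
        _ ≤ n * Real.exp (-(κ ^ 2 / (2 * M ^ 2) * t)) * Real.exp (-(κ ^ 2 / (2 * M ^ 2))) := by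
            gcongr
        _ = n * Real.exp (-(κ ^ 2 / (2 * M ^ 2) * (t + 1 : ℕ))) := by
            rw [mul_assoc, ← Real.exp_add]
            push_cast
            ring_nf
  have hlog : Real.log (n * Real.exp 1 / ε) ≤ κ ^ 2 / (2 * M ^ 2) * T := by
    have h := mul_le_mul_of_nonneg_left hT (by positivity : 0 ≤ κ ^ 2 / (2 * M ^ 2))
    refine le_trans (le_of_eq ?_) h
    have := hκ.ne'
    field_simp
  calc (∑ i, if m (θ T) i ≤ 0 then (1 : ℝ) else 0)
      ≤ L T := by
        refine Finset.sum_le_sum fun i _ => ?_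
        split_ifs with h
        · exact Real.one_le_exp (neg_nonneg.2 h)
        · exact (Real.exp_pos _).le
    _ ≤ n * Real.exp (-(κ ^ 2 / (2 * M ^ 2) * T)) := hL_le T
    _ ≤ n * Real.exp (-Real.log (n * Real.exp 1 / ε)) := by gcongr
    _ = ε * Real.exp (-1) := by
        rw [Real.exp_neg, Real.exp_log (by positivity), Real.exp_neg]
        field_simp
    _ ≤ ε := mul_le_of_le_one_right hε.le (Real.exp_le_one_iff.2 (by norm_num))
end
end

section
/- For every matrix Z ∈ ℝ^{n×p} and every q ∈ [1,∞) with conjugate exponent q⋆ (1/q + 1/q⋆ = 1, q⋆ = ∞ when q = 1), the minimax equality max{ min_{1≤i≤n} (Zθ)_i : θ ∈ ℝ^p, ‖θ‖_q ≤ 1 } = min{ ‖Zᵀη‖_{q⋆} : η ∈ Δ_n } holds, where both the maximum and the minimum are attained. -/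
open Filter

noncomputable section

lemma lqNorm_le_one_iff {q : ℝ} (hq : 0 < q) {p : ℕ} (u : Fin p → ℝ) :
    lqNorm q u ≤ 1 ↔ ∑ j, |u j| ^ q ≤ 1 := by
  have hsum : 0 ≤ ∑ j, |u j| ^ q :=
    Finset.sum_nonneg fun j _ => Real.rpow_nonneg (abs_nonneg _) _
  simpa [lqNorm] using
    Real.rpow_le_rpow_iff hsum zero_le_one (show 0 < 1 / q by positivity)

lemma lqNorm_eq_norm_toLp {q : ℝ} (hq : 0 < q) {p : ℕ} (u : Fin p → ℝ) :
    lqNorm q u = ‖WithLp.toLp (ENNReal.ofReal q) u‖ := by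
  rw [PiLp.norm_eq_sum (by rwa [ENNReal.toReal_ofReal hq.le]), ENNReal.toReal_ofReal hq.le]
  rfl

lemma setOf_lqNorm_le_one_eq_image {q : ℝ} (hq : 0 < q) [Fact (1 ≤ ENNReal.ofReal q)] (p : ℕ) :
    {u : Fin p → ℝ | lqNorm q u ≤ 1} =
      (PiLp.continuousLinearEquiv (ENNReal.ofReal q) ℝ fun _ : Fin p => ℝ) ''
        Metric.closedBall 0 1 := by
  ext u
  constructor
  · intro hu
    exact ⟨WithLp.toLp _ u, by simpa [← lqNorm_eq_norm_toLp hq] using hu, rfl⟩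
  · rintro ⟨x, hx, rfl⟩
    rw [Set.mem_ofPred_eq, lqNorm_eq_norm_toLp hq]
    exact mem_closedBall_zero_iff.1 hx

lemma isCompact_setOf_lqNorm_le_one {q : ℝ} (hq : 1 ≤ q) (p : ℕ) :
    IsCompact {u : Fin p → ℝ | lqNorm q u ≤ 1} := by
  have : Fact (1 ≤ ENNReal.ofReal q) := ⟨ENNReal.one_le_ofReal.2 hq⟩
  rw [setOf_lqNorm_le_one_eq_image (by linarith) p]
  exact (isCompact_closedBall _ _).image (ContinuousLinearEquiv.continuous _)

lemma convex_setOf_lqNorm_le_one {q : ℝ} (hq : 1 ≤ q) (p : ℕ) :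
    Convex ℝ {u : Fin p → ℝ | lqNorm q u ≤ 1} := by
  have : Fact (1 ≤ ENNReal.ofReal q) := ⟨ENNReal.one_le_ofReal.2 hq⟩
  rw [setOf_lqNorm_le_one_eq_image (by linarith) p]
  exact (convex_closedBall 0 1).linear_image
    (PiLp.continuousLinearEquiv (ENNReal.ofReal q) ℝ fun _ : Fin p => ℝ).toLinearMap

/-- The dual norm of `u` is the maximum of the pairing with `u` over the unit ball. -/
lemma isGreatest_lqDualNorm {q : ℝ} (hq : 1 ≤ q) {p : ℕ} (u : Fin p → ℝ) :
    IsGreatest ((fun θ : Fin p → ℝ => ∑ j, u j * θ j) '' {θ | lqNorm q θ ≤ 1})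
      (lqDualNorm q u) := by
  have hq0 : 0 < q := by linarith
  have abs_sign_le (x : ℝ) : |(SignType.sign x : ℝ)| ≤ 1 := by
    rcases lt_trichotomy x 0 with h | h | h <;> simp [h]
  rcases eq_or_lt_of_le hq with rfl | hq1
  · have hle (j : Fin p) : |u j| ≤ ⨆ j, |u j| :=
      le_ciSup (f := fun j => |u j|) (Finite.bddAbove_range _) j
    simp only [lqDualNorm, if_true]
    constructor
    · rcases isEmpty_or_nonempty (Fin p)
      · exact ⟨0, by simp [lqNorm], by simp⟩
      · obtain ⟨k, hk⟩ := exists_eq_ciSup_of_finite (f := fun j => |u j|)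
        refine ⟨Pi.single k (SignType.sign (u k) : ℝ), ?_, ?_⟩
        · simp only [Set.mem_ofPred_eq, lqNorm_le_one_iff hq0, Real.rpow_one]
          rw [Finset.sum_eq_single k (by intro j _ hj; simp [hj]) (by simp)]
          simpa using abs_sign_le (u k)
        · rw [← hk]
          simp [Pi.single_apply]
    · rintro _ ⟨θ, hθ, rfl⟩
      simp only [Set.mem_ofPred_eq, lqNorm_le_one_iff hq0, Real.rpow_one] at hθ
      calc ∑ j, u j * θ j ≤ ∑ j, (⨆ j, |u j|) * |θ j| := by
            refine Finset.sum_le_sum fun j _ => (le_abs_self _).trans ?_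
            rw [abs_mul]
            gcongr
            exact hle j
        _ = (⨆ j, |u j|) * ∑ j, |θ j| := by rw [Finset.mul_sum]
        _ ≤ ⨆ j, |u j| := mul_le_of_le_one_right (Real.iSup_nonneg fun j => abs_nonneg _) hθ
  · have hpq : (q / (q - 1)).HolderConjugate q := (Real.HolderConjugate.conjExponent hq1).symm
    have hmax := NNReal.isGreatest_Lp Finset.univ (fun j => Real.nnabs (u j)) hpq
    have hnorm : lqDualNorm q u =
        (((∑ j, Real.nnabs (u j) ^ (q / (q - 1))) ^ (1 / (q / (q - 1))) : NNReal) : ℝ) := by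
      simp [lqDualNorm, hq1.ne']
    rw [hnorm]
    constructor
    · obtain ⟨g, hg, hgu⟩ := hmax.1
      refine ⟨fun j => SignType.sign (u j) * g j, ?_, ?_⟩
      · simp only [Set.mem_ofPred_eq, lqNorm_le_one_iff hq0]
        have hg' : ∑ j, (g j : ℝ) ^ q ≤ 1 := by exact_mod_cast hg
        refine (Finset.sum_le_sum fun j _ => ?_).trans hg'
        refine Real.rpow_le_rpow (abs_nonneg _) ?_ hq0.le
        rw [abs_mul, NNReal.abs_eq]
        exact mul_le_of_le_one_left (g j).2 (abs_sign_le _)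
      · rw [← hgu]
        simp [← mul_assoc]
    · rintro _ ⟨θ, hθ, rfl⟩
      simp only [Set.mem_ofPred_eq, lqNorm_le_one_iff hq0] at hθ
      have h := hmax.2 ⟨fun j => Real.nnabs (θ j), by
        rw [Set.mem_ofPred_eq, ← NNReal.coe_le_coe]
        simpa using hθ, rfl⟩
      rw [← NNReal.coe_le_coe] at h
      refine le_trans ?_ h
      simp only [NNReal.coe_sum, NNReal.coe_mul, Real.coe_nnabs, ← abs_mul]
      exact Finset.sum_le_sum fun j _ => le_abs_self _

/-- A convex set of vectors each having some coordinate at most `v` has a simplex weight whose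
weighted averages on the set are all at most `v`. -/
lemma exists_mem_stdSimplex_forall_sum_mul_le {ι : Type*} [Fintype ι] [Nonempty ι]
    {C : Set (ι → ℝ)} (hC : Convex ℝ C) {v : ℝ} (hv : ∀ c ∈ C, ∃ i, c i ≤ v) :
    ∃ η ∈ stdSimplex ℝ ι, ∀ c ∈ C, ∑ i, η i * c i ≤ v := by
  classical
  rcases C.eq_empty_or_nonempty with rfl | ⟨c₀, hc₀⟩
  · exact ⟨_, single_mem_stdSimplex ℝ (Classical.arbitrary ι), by simp⟩
  have hU : Set.pi Set.univ (fun _ : ι => Set.Ioi v) = {x : ι → ℝ | ∀ i, v < x i} := by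
    ext; simp
  have hdisj : Disjoint (Set.pi Set.univ fun _ : ι => Set.Ioi v) C := by
    rw [hU, Set.disjoint_left]
    intro x hx hxC
    obtain ⟨i, hi⟩ := hv x hxC
    exact absurd (hx i) hi.not_gt
  obtain ⟨f, s, hfU, hfC⟩ := geometric_hahn_banach_open
    (convex_pi fun _ _ => convex_Ioi v) (isOpen_set_pi Set.finite_univ fun _ _ => isOpen_Ioi)
    hC hdisj
  rw [hU] at hfU
  set w : ι → ℝ := fun i => -f (Pi.single i 1) with hw
  have hf (x : ι → ℝ) : f x = -∑ i, w i * x i := by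
    conv_lhs => rw [pi_eq_sum_univ' x, map_sum]
    simp only [hw, neg_mul, Finset.sum_neg_distrib, neg_neg]
    refine Finset.sum_congr rfl fun i _ => ?_
    rw [map_smul, smul_eq_mul, mul_comm]
  have hclosure (x : ι → ℝ) (hx : ∀ i, v ≤ x i) : f x ≤ s := by
    have hlim : Tendsto (fun ε : ℝ => f (fun i => x i + ε)) (nhdsWithin 0 (Set.Ioi 0))
        (nhds (f x)) := by
      have : Continuous fun ε : ℝ => f (fun i => x i + ε) := by fun_prop
      simpa using (this.tendsto 0).mono_left nhdsWithin_le_nhds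
    refine le_of_tendsto hlim (eventually_mem_nhdsWithin.mono fun ε hε => ?_)
    exact (hfU _ fun i => lt_add_of_le_of_pos (hx i) hε).le
  have hw_nonneg (i : ι) : 0 ≤ w i := by
    by_contra! hi
    have hs (t : ℝ) (ht : 0 ≤ t) : f (fun _ => v) - t * w i ≤ s := by
      have h := hclosure ((fun _ => v) + t • Pi.single i 1) fun j => by
        have : (0 : ℝ) ≤ (Pi.single i 1 : ι → ℝ) j := by
          by_cases h : j = i <;> simp [h]
        simpa using mul_nonneg ht this
      rw [map_add, map_smul, smul_eq_mul] at h
      simp only [hw]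
      linarith
    have h0 : 0 ≤ s - f (fun _ => v) := by linarith [hclosure _ fun _ => le_refl v]
    have h := hs ((s - f (fun _ => v) + 1) / -w i) (by apply div_nonneg <;> linarith)
    have : (s - f (fun _ => v) + 1) / -w i * w i = -(s - f (fun _ => v) + 1) := by
      rw [div_neg, neg_mul, div_mul_cancel₀ _ hi.ne]
    linarith
  have hsum : 0 < ∑ i, w i := by
    refine (Finset.sum_nonneg fun i _ => hw_nonneg i).lt_of_ne' fun h => ?_
    have hzero : ∀ i, w i = 0 := by
      simpa using (Finset.sum_eq_zero_iff_of_nonneg fun i _ => hw_nonneg i).1 h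
    have h₁ := hfU (fun _ => v + 1) (by simp)
    have h₂ := hfC c₀ hc₀
    rw [hf] at h₁ h₂
    simp only [hzero, zero_mul, Finset.sum_const_zero] at h₁ h₂
    linarith
  refine ⟨fun i => w i / ∑ i, w i, ⟨fun i => div_nonneg (hw_nonneg i) hsum.le, ?_⟩, ?_⟩
  · rw [← Finset.sum_div, div_self hsum.ne']
  · intro c hc
    have h₁ := (hclosure _ fun _ => le_refl v).trans (hfC c hc)
    rw [hf, hf, neg_le_neg_iff, ← Finset.sum_mul] at h₁
    simp only [div_mul_eq_mul_div]
    rw [← Finset.sum_div, div_le_iff₀ hsum]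
    linarith

/-- **(von Neumann minimax duality for the ℓq margin).** The max-ℓq-margin equals the minimum
over the simplex of the dual norm of `Zᵀη`, and both optima are attained. -/
theorem minimax_margin_duality
    (n p : ℕ) (hn : 0 < n) (q : ℝ) (hq : 1 ≤ q)
    (Z : Fin n → Fin p → ℝ) :
    ∃ θ₀ : Fin p → ℝ, ∃ η₀ : Fin n → ℝ,
      lqNorm q θ₀ ≤ 1 ∧ (∀ i, 0 ≤ η₀ i) ∧ (∑ i, η₀ i) = 1 ∧
      (∀ θ : Fin p → ℝ, lqNorm q θ ≤ 1 →
        (⨅ i, ∑ j, Z i j * θ j) ≤ ⨅ i, ∑ j, Z i j * θ₀ j) ∧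
      (∀ η : Fin n → ℝ, (∀ i, 0 ≤ η i) → (∑ i, η i) = 1 →
        lqDualNorm q (fun j => ∑ i, Z i j * η₀ i) ≤
          lqDualNorm q (fun j => ∑ i, Z i j * η i)) ∧
      (⨅ i, ∑ j, Z i j * θ₀ j) = lqDualNorm q (fun j => ∑ i, Z i j * η₀ i) := by
  have : Nonempty (Fin n) := ⟨⟨0, hn⟩⟩
  have hpair (η : Fin n → ℝ) (θ : Fin p → ℝ) :
      ∑ j, (∑ i, Z i j * η i) * θ j = ∑ i, η i * ∑ j, Z i j * θ j := by
    simp only [Finset.sum_mul, Finset.mul_sum]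
    rw [Finset.sum_comm]
    exact Finset.sum_congr rfl fun i _ => Finset.sum_congr rfl fun j _ => by ring
  have hcont : Continuous fun θ : Fin p → ℝ => ⨅ i, ∑ j, Z i j * θ j := by
    simp only [← Finset.inf'_univ_eq_ciInf]
    exact Continuous.finset_inf'_apply _ fun i _ => by fun_prop
  obtain ⟨θ₀, hθ₀, hmax⟩ := (isCompact_setOf_lqNorm_le_one hq p).exists_isMaxOn
    ⟨0, (lqNorm_le_one_iff (by linarith) _).2 (by
      simp [Real.zero_rpow (show q ≠ 0 by linarith)])⟩ hcont.continuousOn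
  obtain ⟨η₀, hη₀, hη₀_le⟩ := exists_mem_stdSimplex_forall_sum_mul_le
    ((convex_setOf_lqNorm_le_one hq p).linear_image (Matrix.mulVecLin (Matrix.of Z)))
    (v := ⨅ i, ∑ j, Z i j * θ₀ j) (by
      rintro _ ⟨θ, hθ, rfl⟩
      obtain ⟨i, hi⟩ := exists_eq_ciInf_of_finite (f := fun i => ∑ j, Z i j * θ j)
      exact ⟨i, hi.trans_le (hmax hθ)⟩)
  have hweak (η : Fin n → ℝ) (hη : ∀ i, 0 ≤ η i) (hη1 : ∑ i, η i = 1) :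
      (⨅ i, ∑ j, Z i j * θ₀ j) ≤ lqDualNorm q (fun j => ∑ i, Z i j * η i) := by
    refine le_trans ?_ ((isGreatest_lqDualNorm hq _).2 ⟨θ₀, hθ₀, rfl⟩)
    simp only [hpair]
    calc (⨅ i, ∑ j, Z i j * θ₀ j) = ∑ i, η i * ⨅ i, ∑ j, Z i j * θ₀ j := by
          rw [← Finset.sum_mul, hη1, one_mul]
      _ ≤ ∑ i, η i * ∑ j, Z i j * θ₀ j := Finset.sum_le_sum fun i _ =>
          mul_le_mul_of_nonneg_left (ciInf_le (Finite.bddBelow_range _) i) (hη i)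
  have hstrong : lqDualNorm q (fun j => ∑ i, Z i j * η₀ i) ≤ ⨅ i, ∑ j, Z i j * θ₀ j := by
    obtain ⟨θ, hθ, h⟩ := (isGreatest_lqDualNorm hq fun j => ∑ i, Z i j * η₀ i).1
    rw [← h]
    simp only [hpair]
    exact hη₀_le _ ⟨θ, hθ, rfl⟩
  exact ⟨θ₀, η₀, hθ₀, hη₀.1, hη₀.2, fun θ hθ => hmax hθ,
    fun η hη hη1 => hstrong.trans (hweak η hη hη1),
    (hweak η₀ hη₀.1 hη₀.2).antisymm hstrong⟩
end
end

section
/- Let δ > 0 and define h_δ(t) := ∫ max(t + δ·g, 0) dgamma(g). Then h_δ is (at least three times) differentiable on ℝ, and for every t ∈ ℝ: (i) |h_δ(t) − max(t,0)| ≤ √(2/π)·δ; (ii) |h_δ′(t)| ≤ 1; (iii) |h_δ″(t)| ≤ 2·δ^{−2}·|t| + 3·√(2/π)·δ^{−1}; and (iv) |h_δ‴(t)| ≤ 6·δ^{−2}. -/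
open MeasureTheory ProbabilityTheory

noncomputable section

/-- Gaussian smoothing of the ReLU at scale `δ`: `h_δ(t) = E[max(t + δ g, 0)]`. -/
def hSmooth (δ t : ℝ) : ℝ := ∫ g, max (t + δ * g) 0 ∂stdGaussian

instance : IsProbabilityMeasure stdGaussian :=
  inferInstanceAs (IsProbabilityMeasure (gaussianReal 0 1))

lemma stdGaussian_singleton (x : ℝ) : stdGaussian {x} = 0 :=
  (nullSingletonClass_gaussianReal one_ne_zero).measure_singleton x

lemma integrable_id_stdGaussian : Integrable (fun g : ℝ ↦ g) stdGaussian :=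
  (memLp_id_gaussianReal' 1 (by simp)).integrable le_rfl

lemma integrable_max_affine_zero (δ t : ℝ) :
    Integrable (fun g ↦ max (t + δ * g) 0) stdGaussian :=
  ((integrable_const t).add (integrable_id_stdGaussian.const_mul δ)).pos_part

lemma gaussianPDFReal_zero_one (x : ℝ) :
    gaussianPDFReal 0 1 x = (√(2 * Real.pi))⁻¹ * Real.exp (-x ^ 2 / 2) := by
  simp [gaussianPDFReal]

lemma continuous_gaussianPDFReal (μ : ℝ) (v : NNReal) : Continuous (gaussianPDFReal μ v) := by
  rw [gaussianPDFReal_def]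
  fun_prop

lemma sqrt_two_div_pi : √(2 / Real.pi) = 2 * (√(2 * Real.pi))⁻¹ := by
  rw [Real.sqrt_div (by norm_num), Real.sqrt_mul (by norm_num)]
  have h : √2 * √2 = (2 : ℝ) := Real.mul_self_sqrt (by norm_num)
  field_simp
  nlinarith

lemma integral_abs_stdGaussian : ∫ g, |g| ∂stdGaussian = √(2 / Real.pi) := by
  have hgamma : ∫ x in Set.Ioi (0 : ℝ), x * Real.exp (-x ^ 2 / 2) = 1 := by
    have h := integral_rpow_mul_exp_neg_mul_rpow (p := 2) (q := 1) (b := 1 / 2)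
      (by norm_num) (by norm_num) (by norm_num)
    have hval : (1 / 2 : ℝ) ^ (-((1 : ℝ) + 1) / 2) * (1 / 2) * Real.Gamma ((1 + 1) / 2) = 1 := by
      norm_num [Real.rpow_neg_one]
    rw [hval] at h
    rw [← h]
    congr 1 with x
    simp only [Real.rpow_one, Real.rpow_two]
    ring_nf
  have habs : ∀ x : ℝ, gaussianPDFReal 0 1 x • |x| =
      (√(2 * Real.pi))⁻¹ * (fun y ↦ y * Real.exp (-y ^ 2 / 2)) |x| := by
    intro x
    simp only [gaussianPDFReal_zero_one, sq_abs, smul_eq_mul]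
    ring
  rw [_root_.stdGaussian, integral_gaussianReal_eq_integral_smul one_ne_zero]
  simp_rw [habs]
  rw [integral_const_mul, integral_comp_abs (f := fun y ↦ y * Real.exp (-y ^ 2 / 2)), hgamma,
    sqrt_two_div_pi]
  ring

lemma abs_hSmooth_sub_max_le {δ : ℝ} (hδ : 0 < δ) (t : ℝ) :
    |hSmooth δ t - max t 0| ≤ √(2 / Real.pi) * δ := by
  have heq : hSmooth δ t - max t 0 = ∫ g, (max (t + δ * g) 0 - max t 0) ∂stdGaussian := by
    rw [integral_sub (integrable_max_affine_zero δ t) (integrable_const _)]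
    simp [hSmooth]
  rw [heq, ← integral_abs_stdGaussian, mul_comm, ← integral_const_mul]
  refine abs_integral_le_integral_abs.trans (integral_mono ?_ ?_ fun g ↦ ?_)
  · exact ((integrable_max_affine_zero δ t).sub (integrable_const _)).abs
  · exact integrable_id_stdGaussian.abs.const_mul δ
  · simpa [abs_mul, abs_of_pos hδ] using abs_max_sub_max_le_abs (t + δ * g) t 0

lemma hasDerivAt_max_add_zero {a t : ℝ} (h : t + a ≠ 0) :
    HasDerivAt (fun s ↦ max (s + a) 0) (if 0 < t + a then 1 else 0) t := by
  have hc : ContinuousAt (fun s : ℝ ↦ s + a) t := by fun_prop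
  rcases h.lt_or_gt with h | h
  · rw [if_neg h.not_gt]
    refine (hasDerivAt_const t (0 : ℝ)).congr_of_eventuallyEq ?_
    filter_upwards [hc.eventually_lt_const h] with s hs
    exact max_eq_right hs.le
  · rw [if_pos h]
    refine ((hasDerivAt_id t).add_const a).congr_of_eventuallyEq ?_
    filter_upwards [hc.eventually_const_lt h] with s hs
    exact max_eq_left hs.le

lemma hasDerivAt_hSmooth {δ : ℝ} (hδ : 0 < δ) (t : ℝ) :
    HasDerivAt (hSmooth δ) (stdGaussian.real (Set.Ioi (-(t / δ)))) t := by
  have hset : ∀ g, 0 < t + δ * g ↔ g ∈ Set.Ioi (-(t / δ)) := by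
    intro g
    rw [Set.mem_Ioi, ← neg_div, div_lt_iff₀ hδ]
    constructor <;> intro h <;> linarith
  have hF' : (fun g ↦ if 0 < t + δ * g then (1 : ℝ) else 0) =
      (Set.Ioi (-(t / δ))).indicator 1 := by
    ext g
    simp only [hset, Set.indicator, Pi.one_apply]
  have h := (hasDerivAt_integral_of_dominated_loc_of_lip (μ := stdGaussian) (s := Set.univ)
    (x₀ := t) (F := fun s g ↦ max (s + δ * g) 0)
    (F' := fun g ↦ if 0 < t + δ * g then (1 : ℝ) else 0) (bound := fun _ ↦ 1)
    Filter.univ_mem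
    (Filter.Eventually.of_forall fun s ↦ (integrable_max_affine_zero δ s).aestronglyMeasurable)
    (integrable_max_affine_zero δ t)
    (by
      rw [hF']
      exact (measurable_one.indicator measurableSet_Ioi).aestronglyMeasurable)
    (Filter.Eventually.of_forall fun g ↦ LipschitzOnWith.of_dist_le_mul fun x _ y _ ↦ by
      simpa [Real.dist_eq] using abs_max_sub_max_le_abs (x + δ * g) (y + δ * g) 0)
    (integrable_const _)
    (by
      have hne : ∀ᵐ g ∂(_root_.stdGaussian), g ≠ -(t / δ) := by
        simpa [ae_iff] using stdGaussian_singleton (-(t / δ))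
      filter_upwards [hne] with g hg
      refine hasDerivAt_max_add_zero fun h0 ↦ hg ?_
      field_simp
      linarith)).2
  rw [hF', integral_indicator_one measurableSet_Ioi] at h
  exact h

lemma stdGaussian_real_Ioi (a : ℝ) :
    stdGaussian.real (Set.Ioi a) = ∫ x in Set.Ioi a, gaussianPDFReal 0 1 x := by
  rw [measureReal_def, _root_.stdGaussian, gaussianReal_apply_eq_integral 0 one_ne_zero,
    ENNReal.toReal_ofReal (integral_nonneg fun x ↦ gaussianPDFReal_nonneg 0 1 x)]

lemma hasDerivAt_stdGaussian_real_Ioi (a : ℝ) :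
    HasDerivAt (fun a ↦ stdGaussian.real (Set.Ioi a)) (-gaussianPDFReal 0 1 a) a := by
  have hint := integrable_gaussianPDFReal 0 1
  have heq : (fun a ↦ stdGaussian.real (Set.Ioi a)) = fun a ↦
      (∫ x in Set.Ioi 0, gaussianPDFReal 0 1 x) - ∫ x in (0 : ℝ)..a, gaussianPDFReal 0 1 x := by
    ext b
    rw [stdGaussian_real_Ioi,
      ← intervalIntegral.integral_Ioi_sub_Ioi' hint.integrableOn hint.integrableOn]
    ring
  rw [heq]
  exact ((continuous_gaussianPDFReal 0 1).integral_hasStrictDerivAt 0 a).hasDerivAt.const_sub _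

lemma hasDerivAt_gaussianPDFReal_zero_one (x : ℝ) :
    HasDerivAt (gaussianPDFReal 0 1) (-x * gaussianPDFReal 0 1 x) x := by
  have h : HasDerivAt (fun x : ℝ ↦ -x ^ 2 / 2) (-x) x := by
    convert! ((hasDerivAt_pow 2 x).neg.div_const 2) using 1
    push_cast
    ring
  rw [funext gaussianPDFReal_zero_one]
  convert! h.exp.const_mul (√(2 * Real.pi))⁻¹ using 1
  ring

lemma deriv_hSmooth {δ : ℝ} (hδ : 0 < δ) :
    deriv (hSmooth δ) = fun t ↦ stdGaussian.real (Set.Ioi (-(t / δ))) :=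
  funext fun t ↦ (hasDerivAt_hSmooth hδ t).deriv

lemma hasDerivAt_deriv_hSmooth {δ : ℝ} (hδ : 0 < δ) (t : ℝ) :
    HasDerivAt (deriv (hSmooth δ)) (gaussianPDFReal 0 1 (t / δ) * δ⁻¹) t := by
  rw [deriv_hSmooth hδ]
  have h : HasDerivAt (fun t ↦ -(t / δ)) (-(1 / δ)) t := ((hasDerivAt_id t).div_const δ).neg
  convert! (hasDerivAt_stdGaussian_real_Ioi (-(t / δ))).comp t h using 1
  simp [gaussianPDFReal_zero_one]

lemma iteratedDeriv_two_hSmooth {δ : ℝ} (hδ : 0 < δ) :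
    iteratedDeriv 2 (hSmooth δ) = fun t ↦ gaussianPDFReal 0 1 (t / δ) * δ⁻¹ := by
  rw [iteratedDeriv_succ, iteratedDeriv_one]
  exact funext fun t ↦ (hasDerivAt_deriv_hSmooth hδ t).deriv

lemma iteratedDeriv_three_hSmooth {δ : ℝ} (hδ : 0 < δ) :
    iteratedDeriv 3 (hSmooth δ) =
      fun t ↦ -(t / δ) * gaussianPDFReal 0 1 (t / δ) * (δ ^ 2)⁻¹ := by
  rw [iteratedDeriv_succ, iteratedDeriv_two_hSmooth hδ]
  ext t
  have h := ((hasDerivAt_gaussianPDFReal_zero_one (t / δ)).comp t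
    ((hasDerivAt_id t).div_const δ)).mul_const δ⁻¹
  refine h.deriv.trans ?_
  field_simp

lemma contDiff_three_hSmooth {δ : ℝ} (hδ : 0 < δ) : ContDiff ℝ 3 (hSmooth δ) := by
  rw [show (3 : WithTop ℕ∞) = 1 + 1 + 1 by norm_num, contDiff_succ_iff_deriv,
    contDiff_succ_iff_deriv]
  refine ⟨fun t ↦ (hasDerivAt_hSmooth hδ t).differentiableAt, by simp,
    fun t ↦ (hasDerivAt_deriv_hSmooth hδ t).differentiableAt, by simp, ?_⟩
  rw [funext fun t ↦ (hasDerivAt_deriv_hSmooth hδ t).deriv]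
  simp only [gaussianPDFReal_zero_one]
  fun_prop

lemma gaussianPDFReal_zero_one_le (x : ℝ) : gaussianPDFReal 0 1 x ≤ (√(2 * Real.pi))⁻¹ := by
  rw [gaussianPDFReal_zero_one]
  refine mul_le_of_le_one_right (by positivity) (Real.exp_le_one_iff.mpr ?_)
  nlinarith [sq_nonneg x]

lemma abs_mul_gaussianPDFReal_zero_one_le (x : ℝ) : |x| * gaussianPDFReal 0 1 x ≤ 1 := by
  have hexp : |x| * Real.exp (-x ^ 2 / 2) ≤ 1 := by
    rw [neg_div, Real.exp_neg, ← div_eq_mul_inv, div_le_one (Real.exp_pos _)]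
    nlinarith [Real.add_one_le_exp (x ^ 2 / 2), sq_nonneg (|x| - 1), sq_abs x]
  have hconst : (√(2 * Real.pi))⁻¹ ≤ 1 := by
    refine inv_le_one_of_one_le₀ (Real.one_le_sqrt.mpr ?_)
    linarith [Real.pi_gt_three]
  rw [gaussianPDFReal_zero_one, mul_left_comm]
  exact mul_le_one₀ hconst (by positivity) hexp

/-- **Lemma A.2 (Gaussian smoothing estimates).** -/
theorem gaussian_smoothing_estimates
    (δ : ℝ) (hδ : 0 < δ) :
    ContDiff ℝ 3 (hSmooth δ) ∧
    ∀ t : ℝ,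
      |hSmooth δ t - max t 0| ≤ Real.sqrt (2 / Real.pi) * δ ∧
      |deriv (hSmooth δ) t| ≤ 1 ∧
      |iteratedDeriv 2 (hSmooth δ) t| ≤ 2 * (δ ^ 2)⁻¹ * |t| + 3 * Real.sqrt (2 / Real.pi) * δ⁻¹ ∧
      |iteratedDeriv 3 (hSmooth δ) t| ≤ 6 * (δ ^ 2)⁻¹ := by
  refine ⟨contDiff_three_hSmooth hδ, fun t ↦ ⟨abs_hSmooth_sub_max_le hδ t, ?_, ?_, ?_⟩⟩
  · rw [deriv_hSmooth hδ, abs_of_nonneg measureReal_nonneg]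
    exact measureReal_le_one
  · rw [iteratedDeriv_two_hSmooth hδ, sqrt_two_div_pi,
      abs_of_nonneg (mul_nonneg (gaussianPDFReal_nonneg _ _ _) (by positivity))]
    have hle : gaussianPDFReal 0 1 (t / δ) ≤ 3 * (2 * (√(2 * Real.pi))⁻¹) := by
      have hpos : 0 ≤ (√(2 * Real.pi))⁻¹ := by positivity
      linarith [gaussianPDFReal_zero_one_le (t / δ)]
    have hnonneg : 0 ≤ 2 * (δ ^ 2)⁻¹ * |t| := by positivity
    linarith [mul_le_mul_of_nonneg_right hle (inv_nonneg.mpr hδ.le)]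
  · rw [iteratedDeriv_three_hSmooth hδ, abs_mul, abs_mul, abs_neg,
      abs_of_nonneg (gaussianPDFReal_nonneg 0 1 (t / δ)),
      abs_of_nonneg (by positivity : 0 ≤ (δ ^ 2)⁻¹)]
    gcongr
    linarith [abs_mul_gaussianPDFReal_zero_one_le (t / δ)]
end
end
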